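/- arXiv:2108.04268 — 7 statements merged into one kernel-verified Lean document; each statement's English description precedes it below -/
import Mathlib

section
/- Let μ be an isotropic log-concave probability measure on ℝ and let d ≥ 1. Then for every polynomial q : ℝ → ℝ of degree at most d−1, ∫_ℝ (x^d − q(x))² dμ(x) ≥ (1/81)·18^{−2d}. In other words, the L²(μ)-distance from x^d to the span of {1, x, …, x^{d−1}} is at least (1/9)·18^{−d}. -/
open MeasureTheory

/-- A measure on `ℝ` is log-concave if it has a density `ρ` with respect to Lebesgue measure
satisfying `ρ((1-l)x + ly) ≥ ρ(x)^(1-l) * ρ(y)^l`. -/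
def IsLogConcaveMeasure (μ : Measure ℝ) : Prop :=
  ∃ ρ : ℝ → ℝ, (∀ x, 0 ≤ ρ x) ∧
    (∀ x y l : ℝ, 0 ≤ l → l ≤ 1 → ρ x ^ (1 - l) * ρ y ^ l ≤ ρ ((1 - l) * x + l * y)) ∧
    μ = volume.withDensity (fun x => ENNReal.ofReal (ρ x))

lemma integral_cos_nat_mul_eq_zero (n : ℕ) (hn : n ≠ 0) :
    ∫ t in (0 : ℝ)..Real.pi, Real.cos (n * t) = 0 := by
  have hn' : (n : ℝ) ≠ 0 := by exact_mod_cast hn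
  rw [intervalIntegral.integral_comp_mul_left (fun x => Real.cos x) hn']
  simp [Real.sin_nat_mul_pi]

lemma integral_sin_nat_mul_sq (n : ℕ) (hn : n ≠ 0) :
    ∫ t in (0 : ℝ)..Real.pi, Real.sin (n * t) ^ 2 = Real.pi / 2 := by
  have h : ∀ t : ℝ, Real.sin (n * t) ^ 2 = 1 / 2 - 1 / 2 * Real.cos ((2 * n : ℕ) * t) := by
    intro t
    rw [Real.sin_sq, Real.cos_sq]
    push_cast
    ring_nf
  simp_rw [h]
  rw [intervalIntegral.integral_sub (Continuous.intervalIntegrable (by fun_prop) _ _)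
    (Continuous.intervalIntegrable (by fun_prop) _ _), intervalIntegral.integral_const_mul,
    integral_cos_nat_mul_eq_zero _ (by omega)]
  simp
  ring

lemma integral_cos_pow_mul_sin_mul_sin (k : ℕ) : ∀ n : ℕ, k ≤ n →
    ∫ t in (0 : ℝ)..Real.pi, Real.cos t ^ k * (Real.sin ((n + 1 : ℕ) * t) * Real.sin t) =
      if k = n then Real.pi / 2 * (1 / 2) ^ k else 0 := by
  induction k with
  | zero =>
    intro n _
    rcases Nat.eq_zero_or_pos n with rfl | hn
    · have := integral_sin_nat_mul_sq 1 one_ne_zero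
      simp only [Nat.cast_one, one_mul] at this
      simp [← sq, this]
    · have h : ∀ t : ℝ, Real.cos t ^ 0 * (Real.sin ((n + 1 : ℕ) * t) * Real.sin t) =
          1 / 2 * Real.cos (n * t) - 1 / 2 * Real.cos ((n + 2 : ℕ) * t) := by
        intro t
        have h₁ : (n : ℝ) * t = (n + 1 : ℕ) * t - t := by push_cast; ring
        have h₂ : ((n + 2 : ℕ) : ℝ) * t = (n + 1 : ℕ) * t + t := by push_cast; ring
        rw [h₁, h₂, Real.cos_sub, Real.cos_add]
        ring
      simp_rw [h]
      rw [intervalIntegral.integral_sub (Continuous.intervalIntegrable (by fun_prop) _ _)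
        (Continuous.intervalIntegrable (by fun_prop) _ _), intervalIntegral.integral_const_mul,
        intervalIntegral.integral_const_mul, integral_cos_nat_mul_eq_zero _ hn.ne',
        integral_cos_nat_mul_eq_zero _ (by omega), if_neg hn.ne]
      simp
  | succ k ih =>
    intro n hn
    obtain ⟨m, rfl⟩ : ∃ m, n = m + 1 := ⟨n - 1, by omega⟩
    have h : ∀ t : ℝ, Real.cos t ^ (k + 1) * (Real.sin ((m + 1 + 1 : ℕ) * t) * Real.sin t) =
        1 / 2 * (Real.cos t ^ k * (Real.sin ((m + 2 + 1 : ℕ) * t) * Real.sin t)) +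
        1 / 2 * (Real.cos t ^ k * (Real.sin ((m + 1 : ℕ) * t) * Real.sin t)) := by
      intro t
      have h₁ : ((m + 1 : ℕ) : ℝ) * t = (m + 1 + 1 : ℕ) * t - t := by push_cast; ring
      have h₂ : ((m + 2 + 1 : ℕ) : ℝ) * t = (m + 1 + 1 : ℕ) * t + t := by push_cast; ring
      rw [h₁, h₂, Real.sin_sub, Real.sin_add]
      ring
    simp_rw [h]
    rw [intervalIntegral.integral_add (Continuous.intervalIntegrable (by fun_prop) _ _)
      (Continuous.intervalIntegrable (by fun_prop) _ _), intervalIntegral.integral_const_mul,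
      intervalIntegral.integral_const_mul, ih _ (by omega), ih _ (by omega),
      if_neg (by omega)]
    by_cases hk : k = m
    · simp [hk]
      ring
    · simp [hk]

lemma integral_eval_cos_mul_sin_mul_sin (p : Polynomial ℝ) (d : ℕ) (hp : p.natDegree ≤ d) :
    ∫ t in (0 : ℝ)..Real.pi, p.eval (Real.cos t) * (Real.sin ((d + 1 : ℕ) * t) * Real.sin t) =
      p.coeff d * (Real.pi / 2 * (1 / 2) ^ d) := by
  have h : ∀ t : ℝ, p.eval (Real.cos t) * (Real.sin ((d + 1 : ℕ) * t) * Real.sin t) =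
      ∑ i ∈ Finset.range (d + 1),
        p.coeff i * (Real.cos t ^ i * (Real.sin ((d + 1 : ℕ) * t) * Real.sin t)) := by
    intro t
    rw [Polynomial.eval_eq_sum_range' (Nat.lt_succ_of_le hp), Finset.sum_mul]
    exact Finset.sum_congr rfl fun i _ => by ring
  simp_rw [h]
  rw [intervalIntegral.integral_finsetSum
    fun i _ => Continuous.intervalIntegrable (by fun_prop) _ _]
  simp_rw [intervalIntegral.integral_const_mul]
  rw [Finset.sum_range_succ, integral_cos_pow_mul_sin_mul_sin _ _ le_rfl, if_pos rfl,
    Finset.sum_eq_zero, zero_add]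
  intro i hi
  have hi := Finset.mem_range.1 hi
  rw [integral_cos_pow_mul_sin_mul_sin _ _ hi.le, if_neg hi.ne, mul_zero]

lemma coeff_sq_mul_le_integral_eval_sq (p : Polynomial ℝ) (d : ℕ) (hp : p.natDegree ≤ d) :
    p.coeff d ^ 2 * (Real.pi / 2 * (1 / 4) ^ d) ≤ ∫ x in (-1 : ℝ)..1, p.eval x ^ 2 := by
  have hsub : ∫ x in (-1 : ℝ)..1, p.eval x ^ 2 =
      ∫ t in (0 : ℝ)..Real.pi, p.eval (Real.cos t) ^ 2 * Real.sin t := by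
    have := intervalIntegral.integral_comp_mul_deriv (a := 0) (b := Real.pi)
      (f := Real.cos) (f' := fun t => -Real.sin t) (g := fun x => p.eval x ^ 2)
      (fun x _ => Real.hasDerivAt_cos x) (by fun_prop) (by fun_prop)
    simp only [Function.comp, Real.cos_zero, Real.cos_pi, mul_neg,
      intervalIntegral.integral_neg] at this
    rw [intervalIntegral.integral_symm, ← this, neg_neg]
  rw [hsub]
  set c := p.coeff d * (1 / 2) ^ d with hc
  have hle : ∫ t in (0 : ℝ)..Real.pi,
      (2 * c * (p.eval (Real.cos t) * (Real.sin ((d + 1 : ℕ) * t) * Real.sin t)) -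
        c ^ 2 * Real.sin ((d + 1 : ℕ) * t) ^ 2) ≤
      ∫ t in (0 : ℝ)..Real.pi, p.eval (Real.cos t) ^ 2 * Real.sin t := by
    refine intervalIntegral.integral_mono_on Real.pi_pos.le
      (Continuous.intervalIntegrable (by fun_prop) _ _)
      (Continuous.intervalIntegrable (by fun_prop) _ _) fun t ht => ?_
    have h₀ := Real.sin_nonneg_of_mem_Icc ht
    have h₁ : Real.sin t ^ 2 ≤ Real.sin t := by nlinarith [Real.sin_le_one t]
    nlinarith [sq_nonneg (p.eval (Real.cos t) * Real.sin t - c * Real.sin ((d + 1 : ℕ) * t)),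
      mul_le_mul_of_nonneg_left h₁ (sq_nonneg (p.eval (Real.cos t)))]
  refine le_trans (le_of_eq ?_) hle
  rw [intervalIntegral.integral_sub (Continuous.intervalIntegrable (by fun_prop) _ _)
    (Continuous.intervalIntegrable (by fun_prop) _ _), intervalIntegral.integral_const_mul,
    intervalIntegral.integral_const_mul, integral_eval_cos_mul_sin_mul_sin p d hp,
    integral_sin_nat_mul_sq _ (by omega), hc]
  have : (1 / 4 : ℝ) ^ d = ((1 / 2) ^ d) ^ 2 := by rw [← pow_mul, mul_comm, pow_mul]; norm_num
  rw [this]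
  ring

/-- A monic polynomial of degree `d` has squared `L²`-norm at least `r (π / 2) (r / 2)^(2d)` on
an interval of radius `r`. -/
lemma Polynomial.Monic.le_integral_eval_sq {p : Polynomial ℝ} (hp : p.Monic) (m r : ℝ)
    (hr : 0 < r) :
    r * (Real.pi / 2) * (r / 2) ^ (2 * p.natDegree) ≤
      ∫ x in (m - r)..(m + r), p.eval x ^ 2 := by
  have hdeg : (Polynomial.C r * Polynomial.X + Polynomial.C m).natDegree = 1 :=
    Polynomial.natDegree_linear hr.ne'
  have hnat : (p.comp (Polynomial.C r * Polynomial.X + Polynomial.C m)).natDegree =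
      p.natDegree := by rw [Polynomial.natDegree_comp, hdeg, mul_one]
  have hlead : (p.comp (Polynomial.C r * Polynomial.X + Polynomial.C m)).coeff p.natDegree =
      r ^ p.natDegree := by
    conv_lhs => rw [← hnat]
    rw [Polynomial.coeff_natDegree, Polynomial.leadingCoeff_comp (by rw [hdeg]; norm_num),
      hp.leadingCoeff, Polynomial.leadingCoeff_linear hr.ne', one_mul]
  have h := coeff_sq_mul_le_integral_eval_sq _ _ hnat.le
  have hcv := intervalIntegral.integral_comp_mul_add (a := -1) (b := 1)
    (fun x => p.eval x ^ 2) hr.ne' m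
  simp only [Polynomial.eval_comp, Polynomial.eval_add, Polynomial.eval_mul, Polynomial.eval_C,
    Polynomial.eval_X] at h
  rw [hlead, hcv, smul_eq_mul, show r * -1 + m = m - r by ring,
    show r * 1 + m = m + r by ring] at h
  have h' := mul_le_mul_of_nonneg_left h hr.le
  rw [mul_inv_cancel_left₀ hr.ne'] at h'
  refine le_trans (le_of_eq ?_) h'
  rw [div_pow, pow_mul, pow_mul, ← pow_mul, mul_comm 2, pow_mul, one_div, inv_pow]
  norm_num
  ring

/-- A nonnegative function `f : ℝ → ℝ` is log-concave. -/
structure IsLogConcaveFun (f : ℝ → ℝ) : Prop where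
  nonneg : ∀ x, 0 ≤ f x
  le_map : ∀ x y l : ℝ, 0 ≤ l → l ≤ 1 → f x ^ (1 - l) * f y ^ l ≤ f ((1 - l) * x + l * y)

/-- The integral of `f` over any interval is at most `1`, tested on constant minorants. -/
def MassLeOne (f : ℝ → ℝ) : Prop :=
  ∀ a b c : ℝ, a ≤ b → 0 ≤ c → (∀ x ∈ Set.Ioo a b, c ≤ f x) → c * (b - a) ≤ 1

lemma MassLeOne.comp_add {f : ℝ → ℝ} (hf : MassLeOne f) (s : ℝ) :
    MassLeOne fun x => f (s + x) := by
  intro a b c hab hc h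
  have := hf (s + a) (s + b) c (by linarith) hc fun x hx => by
    have := h (x - s) ⟨by linarith [hx.1], by linarith [hx.2]⟩
    simpa using this
  linarith

lemma MassLeOne.comp_neg {f : ℝ → ℝ} (hf : MassLeOne f) : MassLeOne fun x => f (-x) := by
  intro a b c hab hc h
  have := hf (-b) (-a) c (by linarith) hc fun x hx => by
    have := h (-x) ⟨by linarith [hx.2], by linarith [hx.1]⟩
    simpa using this
  linarith

namespace IsLogConcaveFun

variable {f : ℝ → ℝ}

lemma comp_add (hf : IsLogConcaveFun f) (s : ℝ) : IsLogConcaveFun fun x => f (s + x) where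
  nonneg x := hf.nonneg _
  le_map x y l h₀ h₁ := by
    refine (hf.le_map (s + x) (s + y) l h₀ h₁).trans (le_of_eq ?_)
    congr 1
    ring

lemma comp_neg (hf : IsLogConcaveFun f) : IsLogConcaveFun fun x => f (-x) where
  nonneg x := hf.nonneg _
  le_map x y l h₀ h₁ := by
    refine (hf.le_map (-x) (-y) l h₀ h₁).trans (le_of_eq ?_)
    congr 1
    ring

lemma le_of_le_of_le (hf : IsLogConcaveFun f) {x y z c : ℝ} (hx : c ≤ f x) (hy : c ≤ f y)
    (hxz : x ≤ z) (hzy : z ≤ y) : c ≤ f z := by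
  rcases le_or_gt c 0 with hc | hc
  · exact hc.trans (hf.nonneg z)
  rcases eq_or_lt_of_le (hxz.trans hzy) with h | h
  · rwa [show z = x by linarith]
  have hyx : 0 < y - x := by linarith
  have hl₀ : 0 ≤ (z - x) / (y - x) := div_nonneg (by linarith) hyx.le
  have hl₁ : (z - x) / (y - x) ≤ 1 := (div_le_one hyx).2 (by linarith)
  have key := hf.le_map x y _ hl₀ hl₁
  have hz : (1 - (z - x) / (y - x)) * x + (z - x) / (y - x) * y = z := by
    field_simp
    ring
  rw [hz] at key
  refine le_trans ?_ key
  calc c = c ^ (1 - (z - x) / (y - x)) * c ^ ((z - x) / (y - x)) := by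
        rw [← Real.rpow_add hc, sub_add_cancel, Real.rpow_one]
    _ ≤ _ := by gcongr; exact Real.rpow_nonneg (hc.le.trans hx) _

lemma measurable (hf : IsLogConcaveFun f) : Measurable f := by
  refine measurable_of_Ici fun c => Set.OrdConnected.measurableSet ⟨fun x hx y hy z hz => ?_⟩
  exact hf.le_of_le_of_le hx hy hz.1 hz.2

lemma le_mul_exp (hf : IsLogConcaveFun f) (h₀ : 0 < f 0) {v t : ℝ} (hv : 0 < v)
    (hfv : f v ≤ f 0 * Real.exp (-1)) (ht : v ≤ t) : f t ≤ f 0 * Real.exp (-(t / v)) := by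
  by_contra! h
  have ht₀ : 0 < t := hv.trans_le ht
  have hl₀ : 0 < v / t := div_pos hv ht₀
  have key := hf.le_map 0 t (v / t) hl₀.le ((div_le_one ht₀).2 ht)
  rw [mul_zero, zero_add, div_mul_cancel₀ _ ht₀.ne'] at key
  have h' : (f 0 * Real.exp (-(t / v))) ^ (v / t) < f t ^ (v / t) :=
    Real.rpow_lt_rpow (by positivity) h hl₀
  rw [Real.mul_rpow h₀.le (Real.exp_pos _).le, ← Real.exp_mul,
    show -(t / v) * (v / t) = -1 by field_simp] at h'
  have h'' := mul_lt_mul_of_pos_left h' (Real.rpow_pos_of_pos h₀ (1 - v / t))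
  rw [← mul_assoc, ← Real.rpow_add h₀, sub_add_cancel, Real.rpow_one] at h''
  linarith

lemma sqrt_mul_abs_sub_le (hf : IsLogConcaveFun f) (hm : MassLeOne f) {x y h : ℝ}
    (hy : h ≤ f y) (hx : h ≤ f x) : √(h * f x) * |x - y| ≤ 2 := by
  have hc : √(h * f x) ≤ f x := by
    rw [Real.sqrt_le_left (hf.nonneg x), sq]
    exact mul_le_mul_of_nonneg_right hx (hf.nonneg x)
  have hmid : √(h * f x) ≤ f ((x + y) / 2) := by
    have := hf.le_map x y (1 / 2) (by norm_num) (by norm_num)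
    rw [show (1 - 1 / 2 : ℝ) = 1 / 2 by norm_num, ← Real.sqrt_eq_rpow, ← Real.sqrt_eq_rpow,
      ← Real.sqrt_mul (hf.nonneg x), show 1 / 2 * x + 1 / 2 * y = (x + y) / 2 by ring] at this
    refine le_trans (Real.sqrt_le_sqrt ?_) this
    rw [mul_comm]
    exact mul_le_mul_of_nonneg_left hy (hf.nonneg x)
  rcases le_total x y with hxy | hxy
  · have := hm x ((x + y) / 2) _ (by linarith) (Real.sqrt_nonneg _) fun z hz =>
      hf.le_of_le_of_le hc hmid hz.1.le hz.2.le
    rw [abs_of_nonpos (by linarith)]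
    linarith
  · have := hm ((x + y) / 2) x _ (by linarith) (Real.sqrt_nonneg _) fun z hz =>
      hf.le_of_le_of_le hmid hc hz.1.le hz.2.le
    rw [abs_of_nonneg (by linarith)]
    linarith

lemma bddAbove_range (hf : IsLogConcaveFun f) (hm : MassLeOne f) {a b : ℝ} (hab : a < b)
    (ha : 0 < f a) (hb : 0 < f b) : BddAbove (Set.range f) := by
  set h := min (f a) (f b)
  have hh : 0 < h := lt_min ha hb
  refine ⟨max h (16 / (h * (b - a) ^ 2)), ?_⟩
  rintro _ ⟨x, rfl⟩
  rcases le_total (f x) h with hx | hx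
  · exact hx.trans (le_max_left _ _)
  refine le_trans ?_ (le_max_right _ _)
  have h₁ := hf.sqrt_mul_abs_sub_le hm (min_le_left _ _ : h ≤ f a) hx
  have h₂ := hf.sqrt_mul_abs_sub_le hm (min_le_right _ _ : h ≤ f b) hx
  have hd : b - a ≤ |x - a| + |x - b| := by
    linarith [le_abs_self (x - a), neg_abs_le (x - b)]
  have h₃ : √(h * f x) * (b - a) ≤ 4 := by
    nlinarith [mul_le_mul_of_nonneg_left hd (Real.sqrt_nonneg (h * f x))]
  have hba : 0 < b - a := by linarith
  rw [le_div_iff₀ (by positivity)]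
  have h₄ : (√(h * f x) * (b - a)) ^ 2 ≤ 4 ^ 2 := by gcongr
  rw [mul_pow, Real.sq_sqrt (mul_nonneg hh.le (hf.nonneg x))] at h₄
  linarith

lemma exists_forall_le_mul (hf : IsLogConcaveFun f) (hm : MassLeOne f) {a b : ℝ} (hab : a < b)
    (ha : 0 < f a) (hb : 0 < f b) : ∃ x₀, 0 < f x₀ ∧ ∀ x, f x ≤ 5 / 4 * f x₀ := by
  have hbdd := hf.bddAbove_range hm hab ha hb
  have hpos : 0 < sSup (Set.range f) := ha.trans_le (le_csSup hbdd ⟨a, rfl⟩)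
  obtain ⟨_, ⟨x₀, rfl⟩, hx₀⟩ := exists_lt_of_lt_csSup (Set.range_nonempty f)
    (show 4 / 5 * sSup (Set.range f) < sSup (Set.range f) by linarith)
  refine ⟨x₀, by linarith, fun x => ?_⟩
  linarith [le_csSup hbdd ⟨x, rfl⟩]

lemma exists_width (hf : IsLogConcaveFun f) (hm : MassLeOne f) (h₀ : 0 < f 0) :
    ∃ V, 0 ≤ V ∧ (∀ t, 0 ≤ t → t < V → f 0 * Real.exp (-1) ≤ f t) ∧
      ∀ v, V < v → f v ≤ f 0 * Real.exp (-1) := by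
  have hc : 0 < f 0 * Real.exp (-1) := by positivity
  have hc₀ : f 0 * Real.exp (-1) ≤ f 0 :=
    mul_le_of_le_one_right h₀.le (Real.exp_le_one_iff.2 (by norm_num))
  set S := {t | 0 ≤ t ∧ f 0 * Real.exp (-1) ≤ f t}
  have hS₀ : (0 : ℝ) ∈ S := ⟨le_rfl, hc₀⟩
  have hbdd : BddAbove S := by
    refine ⟨1 / (f 0 * Real.exp (-1)), fun t ht => ?_⟩
    have := hm 0 t _ ht.1 hc.le fun z hz => hf.le_of_le_of_le hc₀ ht.2 hz.1.le hz.2.le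
    rw [le_div_iff₀ hc]
    linarith
  refine ⟨sSup S, le_csSup hbdd hS₀, fun t ht htV => ?_, fun v hv => ?_⟩
  · obtain ⟨s, hs, hts⟩ := exists_lt_of_lt_csSup ⟨0, hS₀⟩ htV
    exact hf.le_of_le_of_le hc₀ hs.2 ht hts.le
  · by_contra! h
    exact absurd (le_csSup hbdd (⟨(le_csSup hbdd hS₀).trans hv.le, h.le⟩ : v ∈ S)) (not_le.2 hv)

lemma le_mul_exp_one_sub (hf : IsLogConcaveFun f) (h₀ : 0 < f 0)
    (hsup : ∀ t, f t ≤ 5 / 4 * f 0) {v t : ℝ} (hv : 0 < v)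
    (hfv : f v ≤ f 0 * Real.exp (-1)) : f t ≤ 5 / 4 * Real.exp 1 * f 0 * Real.exp (-(t / v)) := by
  rcases le_total v t with h | h
  · refine (hf.le_mul_exp h₀ hv hfv h).trans ?_
    have : 1 ≤ Real.exp 1 := Real.one_le_exp (by norm_num)
    have h' : 0 < f 0 * Real.exp (-(t / v)) := by positivity
    nlinarith
  · refine (hsup t).trans ?_
    have : 1 ≤ Real.exp 1 * Real.exp (-(t / v)) := by
      rw [← Real.exp_add]
      refine Real.one_le_exp ?_
      have := (div_le_one hv).2 h
      linarith
    nlinarith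

lemma integrableOn_pow_mul (hf : IsLogConcaveFun f) {C v : ℝ} (hv : 0 < v)
    (h : ∀ t, f t ≤ C * Real.exp (-(t / v))) (n : ℕ) :
    IntegrableOn (fun t => t ^ n * f t) (Set.Ioi 0) := by
  have hi := (integrableOn_rpow_mul_exp_neg_mul_rpow (s := n) (p := 1) (b := 1 / v)
    (by linarith [n.cast_nonneg (α := ℝ)]) one_pos (by positivity)).const_mul C
  refine hi.mono' (by have := hf.measurable; fun_prop) ?_
  refine (ae_restrict_iff' measurableSet_Ioi).2 (ae_of_all _ fun t (ht : 0 < t) => ?_)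
  rw [Real.norm_of_nonneg (mul_nonneg (by positivity) (hf.nonneg t)), Real.rpow_natCast,
    Real.rpow_one]
  have := mul_le_mul_of_nonneg_left (h t) (pow_pos ht n).le
  rw [show -(1 / v) * t = -(t / v) by ring]
  linarith

lemma integral_sq_mul_le (hf : IsLogConcaveFun f) {C v : ℝ} (hv : 0 < v)
    (h : ∀ t, f t ≤ C * Real.exp (-(t / v))) :
    ∫ t in Set.Ioi 0, t ^ 2 * f t ≤ 2 * C * v ^ 3 := by
  have hi := (integrableOn_rpow_mul_exp_neg_mul_rpow (s := 2) (p := 1) (b := 1 / v)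
    (by norm_num) one_pos (by positivity)).const_mul C
  have hle := setIntegral_mono_on (hf.integrableOn_pow_mul hv h 2) hi measurableSet_Ioi
    fun t (ht : 0 < t) => by
      have := mul_le_mul_of_nonneg_left (h t) (pow_pos ht 2).le
      rw [show -(1 / v) * t ^ (1 : ℝ) = -(t / v) by rw [Real.rpow_one]; ring, Real.rpow_two]
      linarith
  refine hle.trans (le_of_eq ?_)
  rw [integral_const_mul, integral_rpow_mul_exp_neg_mul_rpow one_pos (by norm_num)
    (by positivity)]
  have hG : Real.Gamma ((2 + 1) / 1) = 2 := by
    rw [div_one]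
    have := Real.Gamma_nat_eq_factorial 2
    norm_num at this ⊢
  rw [hG, show (-(2 + 1) / 1 : ℝ) = -(3 : ℕ) by norm_num, Real.rpow_neg (by positivity),
    Real.rpow_natCast]
  field_simp

end IsLogConcaveFun

lemma integrable_of_integrableOn_Ioi_of_comp_neg {g : ℝ → ℝ}
    (h₁ : IntegrableOn g (Set.Ioi 0)) (h₂ : IntegrableOn (fun t => g (-t)) (Set.Ioi 0)) :
    Integrable g := by
  have h₃ : IntegrableOn g (Set.Iic 0) := by
    rw [integrableOn_Iic_iff_integrableOn_Iio]
    have := IntegrableOn.comp_neg_Iio (c := (0 : ℝ)) (f := fun t => g (-t)) (by rwa [neg_zero])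
    simpa only [neg_neg] using this
  rw [← integrableOn_univ, ← Set.Iic_union_Ioi (a := (0 : ℝ))]
  exact h₃.union h₁

namespace IsLogConcaveFun

variable {f : ℝ → ℝ}

lemma integrable_pow_mul (hf : IsLogConcaveFun f) (hm : MassLeOne f) (h₀ : 0 < f 0)
    (hsup : ∀ t, f t ≤ 5 / 4 * f 0) (n : ℕ) : Integrable fun t => t ^ n * f t := by
  obtain ⟨V, hV, -, hV'⟩ := hf.exists_width hm h₀
  obtain ⟨U, hU, -, hU'⟩ := hf.comp_neg.exists_width hm.comp_neg (by simpa using h₀)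
  have h₁ := hf.integrableOn_pow_mul (v := V + 1) (by linarith)
    (fun t => hf.le_mul_exp_one_sub h₀ hsup (by linarith) (hV' _ (by linarith))) n
  have h₂ := hf.comp_neg.integrableOn_pow_mul (v := U + 1) (by linarith)
    (fun t => hf.comp_neg.le_mul_exp_one_sub (by simpa using h₀)
      (by simpa using fun t => hsup (-t)) (by linarith) (hU' _ (by linarith))) n
  refine integrable_of_integrableOn_Ioi_of_comp_neg h₁ ?_
  refine (h₂.const_mul ((-1) ^ n)).congr (ae_of_all _ fun t => ?_)
  simp only [neg_pow t n]
  ring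

/-- A log-concave density which nearly attains its supremum at `0` and whose second moment is at
least `1` is bounded below on an interval around `0` that is not too short. -/
lemma exists_le_on_Ioo (hf : IsLogConcaveFun f) (hm : MassLeOne f) (h₀ : 0 < f 0)
    (hsup : ∀ t, f t ≤ 5 / 4 * f 0) (hvar : 1 ≤ ∫ t, t ^ 2 * f t) :
    ∃ U V : ℝ, 0 ≤ U ∧ 0 ≤ V ∧ 1 ≤ 5 / 2 * Real.exp 1 * f 0 * (U + V) ^ 3 ∧
      ∀ t ∈ Set.Ioo (-U) V, f 0 * Real.exp (-1) ≤ f t := by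
  obtain ⟨V, hV, hV₁, hV'⟩ := hf.exists_width hm h₀
  obtain ⟨U, hU, hU₁, hU'⟩ := hf.comp_neg.exists_width hm.comp_neg (by simpa using h₀)
  refine ⟨U, V, hU, hV, ?_, fun t ht => ?_⟩
  · set K := 5 / 2 * Real.exp 1 * f 0 with hK
    have hbound : ∀ ε, 0 < ε → 1 ≤ K * (U + ε) ^ 3 + K * (V + ε) ^ 3 := by
      intro ε hε
      have h₁ := hf.integral_sq_mul_le (v := V + ε) (by linarith)
        (fun t => hf.le_mul_exp_one_sub h₀ hsup (by linarith) (hV' _ (by linarith)))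
      have h₂ := hf.comp_neg.integral_sq_mul_le (v := U + ε) (by linarith)
        (fun t => hf.comp_neg.le_mul_exp_one_sub (by simpa using h₀)
          (by simpa using fun t => hsup (-t)) (by linarith) (hU' _ (by linarith)))
      have h₃ := integral_comp_neg_Ioi 0 fun t => t ^ 2 * f t
      simp only [neg_sq, neg_zero] at h₃ h₂
      rw [h₃] at h₂
      have h₄ := integral_add_compl (measurableSet_Ioi (a := (0 : ℝ)))
        (hf.integrable_pow_mul hm h₀ hsup 2)
      rw [Set.compl_Ioi] at h₄
      rw [← h₄] at hvar
      rw [hK]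
      linarith
    have hlim : Filter.Tendsto (fun ε => K * (U + ε) ^ 3 + K * (V + ε) ^ 3)
        (nhdsWithin 0 (Set.Ioi 0)) (nhds (K * (U + 0) ^ 3 + K * (V + 0) ^ 3)) := by
      refine Filter.Tendsto.mono_left (Continuous.tendsto ?_ 0) nhdsWithin_le_nhds
      fun_prop
    have h := ge_of_tendsto hlim (Filter.eventually_of_mem self_mem_nhdsWithin hbound)
    have hK₀ : 0 ≤ K := by positivity
    refine h.trans ?_
    have : U ^ 3 + V ^ 3 ≤ (U + V) ^ 3 := by
      have : 0 ≤ U * V * (U + V) := by positivity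
      nlinarith
    rw [add_zero, add_zero]
    nlinarith
  · rcases le_total 0 t with h | h
    · exact hV₁ t h ht.2
    · simpa using hU₁ (-t) (by linarith) (by linarith [ht.1])

end IsLogConcaveFun

lemma le_of_width_bounds {H L : ℝ} (hL : 0 < L) (hH : 0 < H)
    (h₁ : 1 ≤ 5 / 2 * Real.exp 1 * H * L ^ 3) (h₂ : H * Real.exp (-1) * L ≤ 1) (d : ℕ)
    (hd : 1 ≤ d) : (1 / 81) * (1 / 18 ^ (2 * d)) ≤
      H * Real.exp (-1) * (L / 2 * (Real.pi / 2) * (L / 2 / 2) ^ (2 * d)) := by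
  set c := H * Real.exp (-1) with hc
  have hc₀ : 0 < c := by positivity
  have he : Real.exp 1 < 2.7182818286 := Real.exp_one_lt_d9
  have hHc : H = c * Real.exp 1 := by
    rw [hc, mul_assoc, ← Real.exp_add]
    simp
  have he₀ := Real.exp_pos 1
  have he₂ : Real.exp 1 ^ 2 ≤ 7.5 := by nlinarith
  have h₃ : 1 ≤ 5 / 2 * 7.5 * (c * L ^ 3) := by
    refine h₁.trans ?_
    rw [hHc, show 5 / 2 * Real.exp 1 * (c * Real.exp 1) * L ^ 3 =
      5 / 2 * Real.exp 1 ^ 2 * (c * L ^ 3) by ring]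
    gcongr
  have h₄ : (2 / 9) ^ 2 ≤ L ^ 2 := by
    have : c * L ^ 3 ≤ L ^ 2 := by nlinarith [mul_le_mul_of_nonneg_right h₂ (sq_nonneg L)]
    nlinarith
  have h₅ : 2 / 9 ≤ L := le_of_sq_le_sq h₄ hL.le
  obtain ⟨k, rfl⟩ : ∃ k, d = k + 1 := ⟨d - 1, by omega⟩
  have h₆ : (1 / 18 : ℝ) ^ (2 * k) ≤ (L / 2 / 2) ^ (2 * k) :=
    pow_le_pow_left₀ (by norm_num) (by linarith) _
  rw [← one_div_pow, mul_add, pow_add, pow_add]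
  have hpi := Real.pi_gt_three
  have h₇ : 1 / 81 * (1 / 18) ^ (2 * 1) ≤
      c * (L / 2 * (Real.pi / 2) * (L / 2 / 2) ^ (2 * 1)) := by
    have : c * (L / 2 * (Real.pi / 2) * (L / 2 / 2) ^ (2 * 1)) = c * L ^ 3 * (Real.pi / 64) := by
      ring
    rw [this]
    have : 1 / 20 * (3 / 64) ≤ c * L ^ 3 * (Real.pi / 64) :=
      mul_le_mul (by linarith) (by linarith) (by norm_num) (by positivity)
    linarith
  have h₈ := mul_le_mul h₆ h₇ (by positivity) (by positivity)
  linarith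

lemma massLeOne_of_isProbabilityMeasure_withDensity {μ : Measure ℝ} [IsProbabilityMeasure μ]
    {ρ : ℝ → ℝ} (hμ : μ = volume.withDensity fun x => ENNReal.ofReal (ρ x)) : MassLeOne ρ := by
  intro a b c hab hc h
  have h₁ : ENNReal.ofReal c * ENNReal.ofReal (b - a) ≤ 1 := by
    calc ENNReal.ofReal c * ENNReal.ofReal (b - a)
        = ∫⁻ _ in Set.Ioo a b, ENNReal.ofReal c := by
          rw [setLIntegral_const, Real.volume_Ioo]
      _ ≤ ∫⁻ x in Set.Ioo a b, ENNReal.ofReal (ρ x) :=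
          setLIntegral_mono' measurableSet_Ioo fun x hx => ENNReal.ofReal_le_ofReal (h x hx)
      _ = μ (Set.Ioo a b) := by rw [hμ, withDensity_apply _ measurableSet_Ioo]
      _ ≤ 1 := prob_le_one
  rw [← ENNReal.ofReal_mul hc, ← ENNReal.ofReal_one] at h₁
  exact (ENNReal.ofReal_le_ofReal_iff zero_le_one).1 h₁

lemma exists_lt_pos_of_isProbabilityMeasure_withDensity {μ : Measure ℝ} [IsProbabilityMeasure μ]
    {ρ : ℝ → ℝ} (hμ : μ = volume.withDensity fun x => ENNReal.ofReal (ρ x)) :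
    ∃ a b, a < b ∧ 0 < ρ a ∧ 0 < ρ b := by
  by_contra! hcon
  have hsub : {x | 0 < ρ x}.Subsingleton := by
    intro a ha b hb
    by_contra hab
    rcases lt_or_gt_of_ne hab with h | h
    · exact absurd hb (not_lt.2 (hcon a b h ha))
    · exact absurd ha (not_lt.2 (hcon b a h hb))
  have hae : (fun x => ENNReal.ofReal (ρ x)) =ᵐ[volume] 0 := by
    filter_upwards [measure_eq_zero_iff_ae_notMem.1 (hsub.measure_zero volume)] with x hx
    exact ENNReal.ofReal_of_nonpos (not_lt.1 hx)
  have h₁ := measure_univ (μ := μ)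
  rw [hμ, withDensity_congr_ae hae] at h₁
  simp at h₁

lemma one_le_integral_sub_sq {μ : Measure ℝ} [IsProbabilityMeasure μ]
    (hX : Integrable (fun x => x) μ) (hX₂ : Integrable (fun x => x ^ 2) μ)
    (hmean : ∫ x, x ∂μ = 0) (hvar : ∫ x, x ^ 2 ∂μ = 1) (s : ℝ) :
    1 ≤ ∫ x, (x - s) ^ 2 ∂μ := by
  have h : ∀ x : ℝ, (x - s) ^ 2 = x ^ 2 + (s ^ 2 - 2 * s * x) := fun x => by ring
  have h₁ : Integrable (fun x => 2 * s * x) μ := hX.const_mul _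
  have h₂ : Integrable (fun x => s ^ 2 - 2 * s * x) μ := (integrable_const _).sub h₁
  simp_rw [h]
  rw [integral_add hX₂ h₂, integral_sub (integrable_const _) h₁, integral_const_mul, hmean, hvar]
  simp [sq_nonneg]

/-- the `L²(μ)`-distance of `x^d` from polynomials of degree `≤ d-1`, for an
isotropic log-concave measure `μ` on `ℝ`, is at least `(1/9)·18^{-d}`. -/
theorem stmt8 (μ : Measure ℝ) [IsProbabilityMeasure μ]
    (hlc : IsLogConcaveMeasure μ)
    (hmean : ∫ x, x ∂μ = 0) (hvar : ∫ x, x ^ 2 ∂μ = 1)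
    (d : ℕ) (hd : 1 ≤ d)
    (q : Polynomial ℝ) (hq : q.natDegree ≤ d - 1) :
    ∫ x, (x ^ d - q.eval x) ^ 2 ∂μ ≥ (1 / 81) * (1 / 18 ^ (2 * d)) := by
  obtain ⟨ρ, hρ₀, hρ, hμ⟩ := hlc
  have hlc : IsLogConcaveFun ρ := ⟨hρ₀, hρ⟩
  have hmeas : Measurable fun x => ENNReal.ofReal (ρ x) := hlc.measurable.ennreal_ofReal
  have hmass : MassLeOne ρ := massLeOne_of_isProbabilityMeasure_withDensity hμ
  obtain ⟨a, b, hab, ha, hb⟩ := exists_lt_pos_of_isProbabilityMeasure_withDensity hμ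
  obtain ⟨x₀, hx₀, hsup⟩ := hlc.exists_forall_le_mul hmass hab ha hb
  have hfin : ∀ᵐ x ∂(volume : Measure ℝ), ENNReal.ofReal (ρ x) < ⊤ := by simp
  have hf := hlc.comp_add x₀
  have hm := hmass.comp_add x₀
  have hf₀ : 0 < ρ (x₀ + 0) := by simpa using hx₀
  have hfsup : ∀ t, ρ (x₀ + t) ≤ 5 / 4 * ρ (x₀ + 0) := fun t => by simpa using hsup (x₀ + t)
  have hpow : ∀ n : ℕ, Integrable (fun x => (x - x₀) ^ n) μ := by
    intro n
    rw [hμ, integrable_withDensity_iff_integrable_smul' hmeas hfin]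
    refine ((hf.integrable_pow_mul hm hf₀ hfsup n).comp_sub_right x₀).congr
      (ae_of_all _ fun x => ?_)
    simp [ENNReal.toReal_ofReal (hρ₀ x), mul_comm]
  have hpoly : ∀ p : Polynomial ℝ, Integrable (fun x => p.eval x) μ := by
    intro p
    set r := p.comp (Polynomial.X + Polynomial.C x₀) with hr
    have : ∀ x, p.eval x =
        ∑ i ∈ Finset.range (r.natDegree + 1), r.coeff i * (x - x₀) ^ i := by
      intro x
      rw [← Polynomial.eval_eq_sum_range]
      simp [hr]
    simp_rw [this]
    exact integrable_finsetSum _ fun i _ => (hpow i).const_mul _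
  have hpoly_sq : ∀ p : Polynomial ℝ, Integrable (fun x => p.eval x ^ 2) μ := fun p =>
    (hpoly (p ^ 2)).congr (ae_of_all _ fun x => Polynomial.eval_pow 2)
  have hsecond : 1 ≤ ∫ t, t ^ 2 * ρ (x₀ + t) := by
    have h₁ : ∫ t, t ^ 2 * ρ (x₀ + t) = ∫ x, (x - x₀) ^ 2 ∂μ := by
      rw [hμ, integral_withDensity_eq_integral_toReal_smul hmeas hfin,
        ← integral_add_left_eq_self (fun x => (ENNReal.ofReal (ρ x)).toReal • (x - x₀) ^ 2) x₀]
      simp [ENNReal.toReal_ofReal (hρ₀ _), mul_comm]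
    rw [h₁]
    exact one_le_integral_sub_sq (by simpa using hpoly Polynomial.X)
      (by simpa using hpoly_sq Polynomial.X) hmean hvar x₀
  obtain ⟨U, V, hU, hV, h₁, hlow⟩ := hf.exists_le_on_Ioo hm hf₀ hfsup hsecond
  simp only [add_zero] at h₁ hlow hf₀
  set c := ρ x₀ * Real.exp (-1) with hc
  have hc₀ : 0 < c := by positivity
  have hUV : 0 < U + V := by
    rcases (add_nonneg hU hV).eq_or_lt with h | h
    · rw [← h] at h₁
      norm_num at h₁
    · exact h
  have h₂ : c * (U + V) ≤ 1 := by
    have := hm (-U) V c (by linarith) hc₀.le hlow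
    linarith
  refine ge_iff_le.2 ((le_of_width_bounds hUV hx₀ h₁ h₂ d hd).trans ?_)
  set p : Polynomial ℝ := Polynomial.X ^ d - q with hp
  have hqd : q.degree < d := by
    refine (Polynomial.degree_le_natDegree).trans_lt ?_
    exact_mod_cast (by omega : q.natDegree < d)
  have hmonic : p.Monic := Polynomial.monic_X_pow_sub hqd
  have hdeg : p.natDegree = d := by
    rw [hp, Polynomial.natDegree_sub_eq_left_of_natDegree_lt, Polynomial.natDegree_X_pow]
    rw [Polynomial.natDegree_X_pow]
    omega
  have hint := hmonic.le_integral_eval_sq (x₀ + (V - U) / 2) ((U + V) / 2) (by linarith)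
  rw [hdeg, show x₀ + (V - U) / 2 - (U + V) / 2 = x₀ - U by ring,
    show x₀ + (V - U) / 2 + (U + V) / 2 = x₀ + V by ring,
    intervalIntegral.integral_of_le (by linarith), integral_Ioc_eq_integral_Ioo] at hint
  have hmeasure : ENNReal.ofReal c • volume.restrict (Set.Ioo (x₀ - U) (x₀ + V)) ≤ μ := by
    refine Measure.le_iff.2 fun s hs => ?_
    rw [hμ, withDensity_apply _ hs, Measure.smul_apply, Measure.restrict_apply hs, smul_eq_mul,
      ← setLIntegral_const]
    refine (setLIntegral_mono' (hs.inter measurableSet_Ioo) fun x hx => ?_).trans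
      (lintegral_mono_set Set.inter_subset_left)
    refine ENNReal.ofReal_le_ofReal ?_
    simpa using hlow (x - x₀) ⟨by linarith [hx.2.1], by linarith [hx.2.2]⟩
  have hmono := integral_mono_measure hmeasure
    (ae_of_all μ fun x => sq_nonneg (p.eval x)) (hpoly_sq p)
  rw [integral_smul_measure, ENNReal.toReal_ofReal hc₀.le, smul_eq_mul] at hmono
  refine (mul_le_mul_of_nonneg_left hint hc₀.le).trans (hmono.trans (le_of_eq ?_))
  simp [hp]
end

section
/- Let p ≥ 1 and let Z be a random vector in ℝⁿ with density (p/(2Γ(1/p)))ⁿ · e^{−‖x‖_p^p} with respect to Lebesgue measure, where Γ is the Gamma function. Then for every real k > −n, E[‖Z‖_p^k] = Γ((n+k)/p) / Γ(n/p). -/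
open MeasureTheory

/-- The `L_p` norm of a vector in `ℝⁿ`. -/
noncomputable def pnorm (p : ℝ) {n : ℕ} (x : Fin n → ℝ) : ℝ :=
  (∑ i, |x i| ^ p) ^ (1 / p)

/-- The probability measure on `ℝⁿ` with density `(p/(2Γ(1/p)))ⁿ e^{-‖x‖_p^p}` with respect
to Lebesgue measure. -/
noncomputable def pGibbs (p : ℝ) (n : ℕ) : Measure (Fin n → ℝ) :=
  volume.withDensity fun x =>
    ENNReal.ofReal ((p / (2 * Real.Gamma (1 / p))) ^ n * Real.exp (-(pnorm p x ^ p)))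

/-- Integration of a function of the `L_p` norm in polar coordinates. -/
theorem integral_fun_pnorm (p : ℝ) (hp : 1 ≤ p) (n : ℕ) (hn : 1 ≤ n) (f : ℝ → ℝ) :
    ∫ x : Fin n → ℝ, f (pnorm p x) =
      n * ((2 * Real.Gamma (1 / p + 1)) ^ n / Real.Gamma ((n : ℝ) / p + 1)) *
        ∫ y in Set.Ioi (0 : ℝ), y ^ (n - 1) * f y := by
  have hp0 : 0 < p := by linarith
  have : Fact (1 ≤ ENNReal.ofReal p) := ⟨ENNReal.ofReal_one ▸ ENNReal.ofReal_le_ofReal hp⟩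
  have : Nonempty (Fin n) := ⟨⟨0, hn⟩⟩
  have h_toReal : (ENNReal.ofReal p).toReal = p := ENNReal.toReal_ofReal hp0.le
  have h_norm (x : Fin n → ℝ) : ‖WithLp.toLp (.ofReal p) x‖ = pnorm p x := by
    simp [pnorm, PiLp.norm_eq_sum (f := WithLp.toLp (.ofReal p) x) (h_toReal.symm ▸ hp0), h_toReal]
  let e := (PiLp.continuousLinearEquiv (.ofReal p) ℝ fun _ : Fin n => ℝ).symm
  let μ : Measure (PiLp (.ofReal p) fun _ : Fin n => ℝ) := volume.map e
  have : μ.IsAddHaarMeasure := e.isAddHaarMeasure_map volume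
  have h_emb : MeasurableEmbedding e := e.toHomeomorph.measurableEmbedding
  have h_ball : μ.real (Metric.ball 0 1) =
      (2 * Real.Gamma (1 / p + 1)) ^ n / Real.Gamma ((n : ℝ) / p + 1) := by
    have h_preimage : e ⁻¹' Metric.ball 0 1 = {x : Fin n → ℝ | ∑ i, |x i| ^ p < 1} := by
      ext x
      have : ‖e x‖ = pnorm p x := h_norm x
      simp only [Set.mem_preimage, mem_ball_zero_iff, Set.mem_ofPred_eq, this, pnorm]
      exact Real.rpow_lt_one_iff' (by positivity) (by positivity)
    rw [measureReal_def, h_emb.map_apply, h_preimage, volume_sum_rpow_lt_one _ hp,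
      Fintype.card_fin, ENNReal.toReal_ofReal]
    have : 0 < Real.Gamma (1 / p + 1) := Real.Gamma_pos_of_pos (by positivity)
    have : 0 < Real.Gamma ((n : ℝ) / p + 1) := Real.Gamma_pos_of_pos (by positivity)
    positivity
  calc
    ∫ x : Fin n → ℝ, f (pnorm p x) = ∫ x, f ‖x‖ ∂μ := by
      rw [h_emb.integral_map]
      exact integral_congr_ae (.of_forall fun x => congrArg f (h_norm x).symm)
    _ = _ := by
      rw [integral_fun_norm_addHaar, h_ball, ← e.toLinearEquiv.finrank_eq, Module.finrank_fin_fun]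
      simp [mul_assoc]

/-- moments of the `L_p` norm under the measure with density
proportional to `e^{-‖x‖_p^p}`. -/
theorem stmt10 (p : ℝ) (hp : 1 ≤ p) (n : ℕ) (hn : 1 ≤ n) (k : ℝ) (hk : -(n : ℝ) < k) :
    ∫ x, pnorm p x ^ k ∂(pGibbs p n) =
      Real.Gamma (((n : ℝ) + k) / p) / Real.Gamma ((n : ℝ) / p) := by
  have hp0 : 0 < p := by linarith
  have hn0 : (0 : ℝ) < n := by exact_mod_cast hn
  have h_gamma_inv : 0 < Real.Gamma (1 / p) := Real.Gamma_pos_of_pos (by positivity)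
  have h_gamma_div : 0 < Real.Gamma ((n : ℝ) / p) := Real.Gamma_pos_of_pos (by positivity)
  have h_radial : ∫ y in Set.Ioi (0 : ℝ), y ^ (n - 1) * (y ^ k * Real.exp (-(y ^ p))) =
      1 / p * Real.Gamma (((n : ℝ) + k) / p) := by
    rw [show (n : ℝ) + k = (n - 1 + k) + 1 by ring,
      ← integral_rpow_mul_exp_neg_rpow hp0 (by linarith)]
    refine setIntegral_congr_fun measurableSet_Ioi fun y hy => ?_
    have hy0 : 0 < y := hy
    rw [Real.rpow_add hy0, ← mul_assoc, ← Real.rpow_natCast, Nat.cast_sub hn, Nat.cast_one]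
  rw [pGibbs, integral_withDensity_eq_integral_toReal_smul (by unfold pnorm; fun_prop) (by simp)]
  have h_integrand (x : Fin n → ℝ) :
      (ENNReal.ofReal ((p / (2 * Real.Gamma (1 / p))) ^ n *
        Real.exp (-(pnorm p x ^ p)))).toReal • pnorm p x ^ k =
      (p / (2 * Real.Gamma (1 / p))) ^ n * (pnorm p x ^ k * Real.exp (-(pnorm p x ^ p))) := by
    rw [ENNReal.toReal_ofReal (by positivity), smul_eq_mul]
    ring
  simp_rw [h_integrand]
  rw [integral_const_mul,
    integral_fun_pnorm p hp n hn fun y => y ^ k * Real.exp (-(y ^ p)), h_radial,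
    Real.Gamma_add_one (by positivity), Real.Gamma_add_one (by positivity)]
  have h_const :
      (p / (2 * Real.Gamma (1 / p))) ^ n * (2 * (1 / p * Real.Gamma (1 / p))) ^ n = 1 := by
    rw [← mul_pow, show p / (2 * Real.Gamma (1 / p)) * (2 * (1 / p * Real.Gamma (1 / p))) = 1 by
      field_simp, one_pow]
  calc
    _ = (p / (2 * Real.Gamma (1 / p))) ^ n * (2 * (1 / p * Real.Gamma (1 / p))) ^ n *
        (n / (n / p * Real.Gamma ((n : ℝ) / p)) * (1 / p) *
          Real.Gamma (((n : ℝ) + k) / p)) := by ring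
    _ = _ := by
      rw [h_const]
      field_simp
end

section
/- Let p ≥ 1 and let Z be a random vector in ℝⁿ with density (p/(2Γ(1/p)))ⁿ · e^{−‖x‖_p^p} with respect to Lebesgue measure. If k ≥ 2 is an integer and n > k², then (1/20)·p^{k/p}·n^{−k/p} ≤ E[‖Z‖_p^{−k}] = Γ((n−k)/p)/Γ(n/p) ≤ 25·p^{k/p}·n^{−k/p}. -/
open MeasureTheory

lemma Real.log_Gamma_add_one {x : ℝ} (hx : 0 < x) :
    Real.log (Real.Gamma (x + 1)) = Real.log x + Real.log (Real.Gamma x) := by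
  rw [Real.Gamma_add_one hx.ne', Real.log_mul hx.ne' (Real.Gamma_pos_of_pos hx).ne']

lemma Real.rpow_neg_sub_le_Gamma_div {x y : ℝ} (hy : 0 < y) (hyx : y < x) :
    x ^ (-(x - y)) ≤ Real.Gamma y / Real.Gamma x := by
  have hx : 0 < x := hy.trans hyx
  have hGx := Real.Gamma_pos_of_pos hx
  have hGy := Real.Gamma_pos_of_pos hy
  have h := Real.convexOn_log_Gamma.slope_mono_adjacent (x := y) (y := x) (z := x + 1)
    (Set.mem_Ioi.2 hy) (Set.mem_Ioi.2 (by linarith)) hyx (by linarith)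
  simp only [Function.comp_apply, Real.log_Gamma_add_one hx] at h
  rw [div_le_iff₀ (sub_pos.2 hyx)] at h
  rw [← Real.log_le_log_iff (by positivity) (by positivity), Real.log_rpow hx,
    Real.log_div hGy.ne' hGx.ne']
  ring_nf at h ⊢
  linarith

lemma Real.Gamma_div_le_div_mul_rpow_neg_sub {x y : ℝ} (hy : 0 < y) (hyx : y < x) :
    Real.Gamma y / Real.Gamma x ≤ x / y * y ^ (-(x - y)) := by
  have hx : 0 < x := hy.trans hyx
  have hGx := Real.Gamma_pos_of_pos hx
  have hGy := Real.Gamma_pos_of_pos hy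
  have h := Real.convexOn_log_Gamma.slope_mono_adjacent (x := y) (y := y + 1) (z := x + 1)
    (Set.mem_Ioi.2 hy) (Set.mem_Ioi.2 (by linarith)) (by linarith) (by linarith)
  simp only [Function.comp_apply, Real.log_Gamma_add_one hx, Real.log_Gamma_add_one hy] at h
  rw [le_div_iff₀ (by linarith)] at h
  rw [← Real.log_le_log_iff (by positivity) (by positivity),
    Real.log_mul (by positivity) (by positivity), Real.log_rpow hy,
    Real.log_div hGy.ne' hGx.ne', Real.log_div hx.ne' hy.ne']
  ring_nf at h ⊢
  linarith

lemma Real.Gamma_div_le_mul_rpow_neg_sub {x y : ℝ} (hy : 0 < y) (hyx : y < x)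
    (hx2 : x ≤ 2 * y) (hsq : (x - y) ^ 2 ≤ 2 * y) :
    Real.Gamma y / Real.Gamma x ≤ 25 * x ^ (-(x - y)) := by
  have hx : 0 < x := hy.trans hyx
  have hpow : y ^ (-(x - y)) ≤ Real.exp 2 * x ^ (-(x - y)) := by
    rw [← Real.log_le_log_iff (by positivity) (by positivity),
      Real.log_mul (by positivity) (by positivity), Real.log_rpow hy, Real.log_rpow hx,
      Real.log_exp]
    have h1 : Real.log x - Real.log y ≤ (x - y) / y := by
      rw [← Real.log_div hx.ne' hy.ne']
      refine (Real.log_le_sub_one_of_pos (by positivity)).trans_eq ?_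
      field_simp
    have h2 : (x - y) * (Real.log x - Real.log y) ≤ 2 :=
      calc (x - y) * (Real.log x - Real.log y) ≤ (x - y) * ((x - y) / y) :=
            mul_le_mul_of_nonneg_left h1 (sub_pos.2 hyx).le
        _ = (x - y) ^ 2 / y := by ring
        _ ≤ 2 := (div_le_iff₀ hy).2 hsq
    linarith
  have hexp : Real.exp 2 ≤ 25 / 2 := by
    have h1 : Real.exp 2 = Real.exp 1 ^ 2 := by rw [← Real.exp_nat_mul]; norm_num
    rw [h1]
    nlinarith [Real.exp_one_lt_d9, Real.exp_pos 1]
  calc Real.Gamma y / Real.Gamma x ≤ x / y * y ^ (-(x - y)) :=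
        Real.Gamma_div_le_div_mul_rpow_neg_sub hy hyx
    _ ≤ 2 * (25 / 2 * x ^ (-(x - y))) := by
        gcongr
        · exact (div_le_iff₀ hy).2 hx2
        · exact hpow.trans (by gcongr)
    _ = 25 * x ^ (-(x - y)) := by ring

lemma pnorm_nonneg (p : ℝ) {n : ℕ} (x : Fin n → ℝ) : 0 ≤ pnorm p x := by
  unfold pnorm; positivity

lemma measurable_pnorm (p : ℝ) (n : ℕ) : Measurable (pnorm p : (Fin n → ℝ) → ℝ) := by
  unfold pnorm; fun_prop

lemma pnorm_rpow_self {p : ℝ} (hp : p ≠ 0) {n : ℕ} (x : Fin n → ℝ) :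
    pnorm p x ^ p = ∑ i, |x i| ^ p := by
  rw [pnorm, ← Real.rpow_mul (by positivity), one_div_mul_cancel hp, Real.rpow_one]

/-- Polar coordinates for functions of the `L_p` norm. -/
lemma exists_integral_comp_pnorm {p : ℝ} (hp : 1 ≤ p) {n : ℕ} (hn : 0 < n) :
    ∃ c : ℝ, ∀ f : ℝ → ℝ,
      ∫ x : Fin n → ℝ, f (pnorm p x) = c * ∫ y in Set.Ioi (0 : ℝ), y ^ (n - 1) * f y := by
  let q := ENNReal.ofReal p
  have hq : q.toReal = p := ENNReal.toReal_ofReal (by linarith)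
  have : Fact (1 ≤ q) := ⟨ENNReal.one_le_ofReal.2 hp⟩
  have : Nonempty (Fin n) := ⟨⟨0, hn⟩⟩
  let L := (PiLp.continuousLinearEquiv q ℝ fun _ : Fin n => ℝ).symm
  let μ : Measure (PiLp q fun _ : Fin n => ℝ) := Measure.map L volume
  have : μ.IsAddHaarMeasure := L.isAddHaarMeasure_map volume
  refine ⟨n * μ.real (Metric.ball 0 1), fun f => ?_⟩
  have hnorm (x : Fin n → ℝ) : ‖L x‖ = pnorm p x := by
    rw [PiLp.norm_eq_sum (by rw [hq]; linarith), hq]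
    rfl
  have h := integral_fun_norm_addHaar μ f
  have hmap : ∫ x, f ‖x‖ ∂μ = ∫ x, f ‖L x‖ :=
    integral_map_equiv (MeasurableEquiv.toLp q (Fin n → ℝ)) fun x => f ‖x‖
  have hdim : Module.finrank ℝ (PiLp q fun _ : Fin n => ℝ) = n := by
    rw [← L.toLinearEquiv.finrank_eq, Module.finrank_fin_fun]
  rw [hmap, hdim] at h
  simpa only [hnorm, nsmul_eq_mul, smul_eq_mul, mul_assoc] using h

lemma integral_exp_neg_pnorm_rpow {p : ℝ} (hp : 0 < p) (n : ℕ) :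
    ∫ x : Fin n → ℝ, Real.exp (-(pnorm p x ^ p)) = (2 * Real.Gamma (1 / p) / p) ^ n := by
  simp only [pnorm_rpow_self hp.ne', ← Finset.sum_neg_distrib, Real.exp_sum]
  rw [integral_fintype_prod_volume_eq_pow fun x : ℝ => Real.exp (-|x| ^ p),
    integral_comp_abs (f := fun x => Real.exp (-x ^ p)), integral_exp_neg_rpow hp,
    Real.Gamma_add_one (by positivity), Fintype.card_fin]
  ring

/-- Negative moments of the `L_p` norm are quotients of Gamma values. -/
lemma integral_pnorm_rpow_neg_pGibbs {p : ℝ} (hp : 1 ≤ p) {n : ℕ} {s : ℝ} (hs : 0 ≤ s)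
    (hsn : s < n) :
    ∫ x, pnorm p x ^ (-s) ∂(pGibbs p n) = Real.Gamma ((n - s) / p) / Real.Gamma (n / p) := by
  have hp0 : 0 < p := by linarith
  have hn' : (0 : ℝ) < n := hs.trans_lt hsn
  have hn : 0 < n := Nat.cast_pos.1 hn'
  have hG : 0 < Real.Gamma (1 / p) := Real.Gamma_pos_of_pos (by positivity)
  have hGn : 0 < Real.Gamma (n / p) := Real.Gamma_pos_of_pos (by positivity)
  obtain ⟨c, hc⟩ := exists_integral_comp_pnorm hp hn
  have hradial {t : ℝ} (ht : t < n) :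
      ∫ x : Fin n → ℝ, pnorm p x ^ (-t) * Real.exp (-(pnorm p x ^ p)) =
        c * (1 / p * Real.Gamma ((n - t) / p)) := by
    rw [hc fun y => y ^ (-t) * Real.exp (-(y ^ p))]
    have h := integral_rpow_mul_exp_neg_rpow (p := p) (q := n - 1 - t) hp0 (by linarith)
    rw [show (n : ℝ) - 1 - t + 1 = n - t by ring] at h
    rw [← h]
    congr 1
    refine setIntegral_congr_fun measurableSet_Ioi fun y hy => ?_
    have hy : 0 < y := hy
    rw [← mul_assoc, ← Real.rpow_natCast, ← Real.rpow_add hy, Nat.cast_sub hn, Nat.cast_one,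
      ← sub_eq_add_neg]
  have hnormalize := integral_exp_neg_pnorm_rpow hp0 n
  have hzero := hradial hn'
  simp only [neg_zero, Real.rpow_zero, one_mul, sub_zero] at hzero
  rw [hnormalize] at hzero
  rw [pGibbs, integral_withDensity_eq_integral_toReal_smul]
  · have hdens (x : Fin n → ℝ) :
        (ENNReal.ofReal ((p / (2 * Real.Gamma (1 / p))) ^ n *
          Real.exp (-(pnorm p x ^ p)))).toReal • pnorm p x ^ (-s) =
        (p / (2 * Real.Gamma (1 / p))) ^ n *
          (pnorm p x ^ (-s) * Real.exp (-(pnorm p x ^ p))) := by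
      rw [ENNReal.toReal_ofReal (by positivity), smul_eq_mul]
      ring
    simp only [hdens]
    rw [integral_const_mul, hradial hsn, eq_div_iff hGn.ne']
    calc (p / (2 * Real.Gamma (1 / p))) ^ n * (c * (1 / p * Real.Gamma ((n - s) / p))) *
          Real.Gamma (n / p)
        = (p / (2 * Real.Gamma (1 / p))) ^ n * (c * (1 / p * Real.Gamma (n / p))) *
          Real.Gamma ((n - s) / p) := by ring
      _ = Real.Gamma ((n - s) / p) := by
        rw [← hzero, ← mul_pow,
          show p / (2 * Real.Gamma (1 / p)) * (2 * Real.Gamma (1 / p) / p) = 1 by field_simp,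
          one_pow, one_mul]
  · have := measurable_pnorm p n
    fun_prop
  · exact ae_of_all _ fun _ => ENNReal.ofReal_lt_top

/-- two-sided estimates for negative moments of the `L_p` norm under the
measure with density proportional to `e^{-‖x‖_p^p}`. -/
theorem stmt11 (p : ℝ) (hp : 1 ≤ p) (k : ℕ) (hk : 2 ≤ k) (n : ℕ) (hn : k ^ 2 < n) :
    (1 / 20) * p ^ ((k : ℝ) / p) * (n : ℝ) ^ (-(k : ℝ) / p) ≤
        ∫ x, pnorm p x ^ (-(k : ℝ)) ∂(pGibbs p n) ∧
      ∫ x, pnorm p x ^ (-(k : ℝ)) ∂(pGibbs p n) =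
        Real.Gamma (((n : ℝ) - k) / p) / Real.Gamma ((n : ℝ) / p) ∧
      ∫ x, pnorm p x ^ (-(k : ℝ)) ∂(pGibbs p n) ≤
        25 * p ^ ((k : ℝ) / p) * (n : ℝ) ^ (-(k : ℝ) / p) := by
  have hp0 : 0 < p := by linarith
  have hk' : (2 : ℝ) ≤ k := by exact_mod_cast hk
  have hn' : (k : ℝ) ^ 2 < n := by exact_mod_cast hn
  have hkn : (2 : ℝ) * k < n := by nlinarith
  have hn0 : (0 : ℝ) < n := by linarith
  have hmoment := integral_pnorm_rpow_neg_pGibbs hp k.cast_nonneg (show (k : ℝ) < n by linarith)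
  have hy : 0 < ((n : ℝ) - k) / p := div_pos (by linarith) hp0
  have hyx : ((n : ℝ) - k) / p < n / p := by gcongr; linarith
  have hsub : (n : ℝ) / p - (n - k) / p = k / p := by ring
  have hpow : ((n : ℝ) / p) ^ (-(k / p) : ℝ) = p ^ ((k : ℝ) / p) * (n : ℝ) ^ (-(k : ℝ) / p) := by
    rw [Real.div_rpow hn0.le hp0.le, Real.rpow_neg hp0.le, div_inv_eq_mul, mul_comm, neg_div]
  rw [hmoment]
  refine ⟨?_, rfl, ?_⟩
  · have h := Real.rpow_neg_sub_le_Gamma_div hy hyx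
    rw [hsub, hpow] at h
    refine le_trans ?_ h
    rw [mul_assoc]
    exact mul_le_of_le_one_left (by positivity) (by norm_num)
  · have h := Real.Gamma_div_le_mul_rpow_neg_sub hy hyx ?_ ?_
    · rwa [hsub, hpow, ← mul_assoc] at h
    · rw [← mul_div_assoc]
      gcongr
      linarith
    · rw [hsub, div_pow, ← mul_div_assoc, div_le_div_iff₀ (by positivity) hp0]
      have h1 : (k : ℝ) ^ 2 ≤ 2 * (n - k) := by linarith
      have h2 : p ≤ p ^ 2 := by nlinarith
      exact mul_le_mul h1 h2 hp0.le (by linarith)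
end

section
/- Fix d ∈ ℕ. There exists a constant C_d > 0, depending only on d, such that for every p ≥ 1, every n > 16d², and every homogeneous polynomial f : ℝⁿ → ℝ of degree d, if X is uniformly distributed on the unit L_p ball B_{p,n} = {x ∈ ℝⁿ : ‖x‖_p ≤ 1}, then E[f(X)²] ≥ C_d · n^{−2d/p} · coeff_d(f)². -/
open MeasureTheory

/-- The `d`-level content of a multivariate polynomial. -/
noncomputable def coeffd {n : ℕ} (d : ℕ) (f : MvPolynomial (Fin n) ℝ) : ℝ :=
  Real.sqrt (∑ m ∈ f.support.filter (fun m => (∑ i, m i) = d), f.coeff m ^ 2)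

/-- The `L_p` ball of radius `r` in `ℝⁿ`. -/
def pball (p : ℝ) (n : ℕ) (r : ℝ) : Set (Fin n → ℝ) :=
  {x | (∑ i, |x i| ^ p) ^ (1 / p) ≤ r}

/-- The uniform (normalized Lebesgue) probability measure on a set `s ⊆ ℝⁿ`. -/
noncomputable def unif {n : ℕ} (s : Set (Fin n → ℝ)) : Measure (Fin n → ℝ) :=
  (volume s)⁻¹ • volume.restrict s

theorem MvPolynomial.IsHomogeneous.sum_eq_of_mem_support {n d : ℕ} {f : MvPolynomial (Fin n) ℝ}
    (hf : f.IsHomogeneous d) {m : Fin n →₀ ℕ} (hm : m ∈ f.support) : ∑ i, m i = d := by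
  have := hf (MvPolynomial.mem_support_iff.1 hm)
  rw [← this, Finsupp.weight_apply, Finsupp.sum_fintype _ _ (by simp)]
  simp

open Polynomial in
theorem exists_monic_orthogonal (L : ℝ[X] →ₗ[ℝ] ℝ) (hL : ∀ q ≠ 0, 0 < L (q * q)) (k : ℕ) :
    ∃ h : ℝ[X], h.Monic ∧ h.natDegree = k ∧ ∀ q : ℝ[X], q.degree < k → L (h * q) = 0 := by
  let V := degreeLT ℝ k
  have : FiniteDimensional ℝ V := (degreeLTEquiv ℝ k).symm.finiteDimensional
  let B : ℝ[X] →ₗ[ℝ] ℝ[X] →ₗ[ℝ] ℝ := (LinearMap.mul ℝ ℝ[X]).compr₂ L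
  have hB : ∀ r q, B r q = L (r * q) := fun r q => rfl
  let T : V →ₗ[ℝ] Module.Dual ℝ V := B.domRestrict₁₂ V V
  have hT : ∀ r q : V, T r q = L (r * q) := fun r q => rfl
  have hinj : Function.Injective T := by
    rw [← LinearMap.ker_eq_bot, LinearMap.ker_eq_bot']
    intro r hr
    by_contra hne
    have h1 := hL r (by simpa using hne)
    rw [← hT, hr] at h1
    simp at h1
  have hsurj : Function.Surjective T :=
    (LinearMap.injective_iff_surjective_of_finrank_eq_finrank
      (Subspace.dual_finrank_eq (K := ℝ) (V := V)).symm).1 hinj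
  obtain ⟨r, hr⟩ := hsurj ((B (X ^ k)).domRestrict V)
  have hrd : (r : ℝ[X]).degree < k := mem_degreeLT.1 r.2
  refine ⟨X ^ k - (r : ℝ[X]), ?_, ?_, fun q hq => ?_⟩
  · exact (monic_X_pow k).sub_of_left (by rwa [degree_X_pow])
  · apply natDegree_eq_of_degree_eq_some
    rw [degree_sub_eq_left_of_degree_lt (by simpa using hrd), degree_X_pow]
  · have := congrArg (fun φ => φ (⟨q, mem_degreeLT.2 hq⟩ : V)) hr
    simp only [hT, LinearMap.domRestrict_apply, hB] at this
    rw [sub_mul, map_sub, this, sub_self]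

open Polynomial in
theorem le_of_monic_orthogonal (L : ℝ[X] →ₗ[ℝ] ℝ) (hL : ∀ q, 0 ≤ L (q * q)) {k : ℕ} {h q : ℝ[X]}
    (hm : h.Monic) (hd : h.natDegree = k) (ho : ∀ r : ℝ[X], r.degree < k → L (h * r) = 0)
    (qm : q.Monic) (qd : q.natDegree = k) : L (h * h) ≤ L (q * q) := by
  have hr : (q - h).degree < k := by
    have h1 : q.degree = h.degree := by
      rw [degree_eq_natDegree qm.ne_zero, degree_eq_natDegree hm.ne_zero, hd, qd]
    have := degree_sub_lt_left h1 qm.ne_zero (by rw [qm.leadingCoeff, hm.leadingCoeff])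
    rwa [degree_eq_natDegree qm.ne_zero, qd] at this
  have : q * q = h * h + (2 : ℝ) • (h * (q - h)) + (q - h) * (q - h) := by
    rw [smul_eq_C_mul]
    simp only [map_ofNat]
    ring
  rw [this, map_add, map_add, map_smul, ho _ hr]
  simpa using hL (q - h)

open Polynomial in
theorem pow_mul_sum_sq_coeff_le {n d : ℕ} (L : ℝ[X] →ₗ[ℝ] ℝ) (hL : ∀ q ≠ 0, 0 < L (q * q))
    (hL1 : L 1 = 1) {κ : ℝ} (κ0 : 0 ≤ κ) (κ1 : κ ≤ 1)
    (hκ : ∀ k ≤ d, ∀ q : ℝ[X], q.Monic → q.natDegree = k → κ ≤ L (q * q))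
    (E : MvPolynomial (Fin n) ℝ →ₗ[ℝ] ℝ)
    (hE : ∀ q : Fin n → ℝ[X], E (∏ i, aeval (MvPolynomial.X i) (q i)) = ∏ i, L (q i))
    (hE0 : ∀ F, 0 ≤ E (F * F)) {f : MvPolynomial (Fin n) ℝ} (hf : f.IsHomogeneous d) :
    κ ^ d * ∑ m ∈ f.support, f.coeff m ^ 2 ≤ E (f * f) := by
  choose h hm hd ho using exists_monic_orthogonal L hL
  let P : (Fin n →₀ ℕ) → MvPolynomial (Fin n) ℝ :=
    fun m => ∏ i, aeval (MvPolynomial.X i) (h (m i))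
  let g : MvPolynomial (Fin n) ℝ := ∑ m ∈ f.support, f.coeff m • P m
  let N : (Fin n →₀ ℕ) → ℝ := fun m => ∏ i, L (h (m i) * h (m i))
  have hdeg : ∀ m ∈ f.support, ∑ i, m i = d := fun m hm => hf.sum_eq_of_mem_support hm
  have hfsum : f = ∑ m ∈ f.support, f.coeff m • ∏ i, aeval (MvPolynomial.X i) (X ^ m i : ℝ[X]) := by
    conv_lhs => rw [f.as_sum]
    refine Finset.sum_congr rfl fun m _ => ?_
    rw [MvPolynomial.monomial_eq, MvPolynomial.smul_eq_C_mul, Finsupp.prod_fintype _ _ (by simp)]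
    simp
  have hlow : ∀ (u : ℕ → ℝ[X]), (∀ k, (u k).Monic) → (∀ k, (u k).natDegree = k) →
      ∀ J ∈ f.support, ∀ I ∈ f.support,
      E ((∏ i, aeval (MvPolynomial.X i) (u (J i))) * P I) = if J = I then N I else 0 := by
    intro u um ud J hJ I hI
    rw [← Finset.prod_mul_distrib]
    simp only [← map_mul]
    rw [hE]
    split_ifs with hJI
    · subst hJI
      refine Finset.prod_congr rfl fun i _ => ?_
      have hr : (u (J i) - h (J i)).degree < (J i : ℕ) := by
        have h1 : (u (J i)).degree = (h (J i)).degree := by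
          rw [degree_eq_natDegree (um _).ne_zero, degree_eq_natDegree (hm _).ne_zero, hd, ud]
        have := degree_sub_lt_left h1 (um _).ne_zero (by rw [(um _).leadingCoeff, (hm _).leadingCoeff])
        rwa [degree_eq_natDegree (um _).ne_zero, ud] at this
      have h2 := ho (J i) _ hr
      rw [mul_sub, map_sub, sub_eq_zero] at h2
      rw [mul_comm, h2]
    · obtain ⟨i, hi⟩ : ∃ i, J i < I i := by
        by_contra! hcon
        apply hJI
        have := (Finset.sum_eq_sum_iff_of_le (fun i _ => hcon i)).1
          ((hdeg I hI).trans (hdeg J hJ).symm)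
        ext i
        exact (this i (Finset.mem_univ i)).symm
      refine Finset.prod_eq_zero (Finset.mem_univ i) ?_
      rw [mul_comm]
      apply ho
      rw [degree_eq_natDegree (um _).ne_zero, ud]
      exact_mod_cast hi
  have hsum : ∀ (u : ℕ → ℝ[X]), (∀ k, (u k).Monic) → (∀ k, (u k).natDegree = k) →
      E ((∑ m ∈ f.support, f.coeff m • ∏ i, aeval (MvPolynomial.X i) (u (m i))) * g) =
        ∑ m ∈ f.support, f.coeff m ^ 2 * N m := by
    intro u um ud
    simp only [g, Finset.sum_mul_sum, map_sum, smul_mul_smul_comm, map_smul]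
    refine Finset.sum_congr rfl fun J hJ => ?_
    rw [Finset.sum_congr rfl fun I hI => by rw [hlow u um ud J hJ I hI]]
    simp [hJ, sq]
  have hfg : E (f * g) = ∑ m ∈ f.support, f.coeff m ^ 2 * N m := by
    have h := hsum (fun k => X ^ k) (fun k => monic_X_pow k) (fun k => natDegree_X_pow k)
    rwa [← hfsum] at h
  have hgg : E (g * g) = ∑ m ∈ f.support, f.coeff m ^ 2 * N m := hsum h hm hd
  have hN : ∀ m ∈ f.support, κ ^ d ≤ N m := by
    intro m hms
    rw [← hdeg m hms, ← Finset.prod_pow_eq_pow_sum]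
    refine Finset.prod_le_prod (fun i _ => by positivity) fun i _ => ?_
    rcases Nat.eq_zero_or_pos (m i) with h0 | h0
    · have : h 0 = 1 := (hm 0).natDegree_eq_zero.1 (hd 0)
      simp [h0, this, hL1]
    · have hle : m i ≤ d := by
        rw [← hdeg m hms]
        exact Finset.single_le_sum (f := fun i => m i) (by simp) (Finset.mem_univ i)
      exact (pow_le_of_le_one κ0 κ1 h0.ne').trans (hκ _ hle _ (hm _) (hd _))
  have hpos := hE0 (f - g)
  have hexp : (f - g) * (f - g) = f * f - (2 : ℝ) • (f * g) + g * g := by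
    rw [MvPolynomial.smul_eq_C_mul]
    simp only [map_ofNat]
    ring
  rw [hexp, map_add, map_sub, map_smul, hfg, hgg, smul_eq_mul] at hpos
  rw [Finset.mul_sum]
  have : ∑ m ∈ f.support, κ ^ d * f.coeff m ^ 2 ≤ ∑ m ∈ f.support, f.coeff m ^ 2 * N m := by
    refine Finset.sum_le_sum fun m hm => ?_
    rw [mul_comm]
    exact mul_le_mul_of_nonneg_left (hN m hm) (sq_nonneg _)
  linarith

open Real in
theorem Gamma_add_le {a θ : ℝ} (ha : 0 < a) (h0 : 0 < θ) (h1 : θ ≤ 1) (k : ℕ) {M : ℝ}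
    (hM0 : 0 < M) (hM : a + k ≤ M + 1) : Gamma (a + k * θ) ≤ Gamma a * M ^ (k * θ) := by
  have hk : ∀ j ≤ k, Gamma (a + j) ≤ Gamma a * M ^ j := by
    intro j
    induction j with
    | zero => simp
    | succ j ih =>
      intro hj
      push_cast
      rw [← add_assoc, Gamma_add_one (by positivity), pow_succ, ← mul_assoc, mul_comm]
      have hj' : (j : ℝ) + 1 ≤ k := by exact_mod_cast hj
      exact mul_le_mul (ih (by omega)) (by linarith) (by positivity)
        (mul_nonneg (Gamma_pos_of_pos ha).le (by positivity))
  rcases h1.eq_or_lt with rfl | h1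
  · simpa [rpow_natCast] using hk k le_rfl
  have hG := Gamma_pos_of_pos ha
  have h := Gamma_mul_add_mul_le_rpow_Gamma_mul_rpow_Gamma ha
    (show 0 < a + k by positivity) (show 0 < 1 - θ by linarith) h0 (by ring)
  calc Gamma (a + k * θ) = Gamma ((1 - θ) * a + θ * (a + k)) := by ring_nf
    _ ≤ Gamma a ^ (1 - θ) * Gamma (a + k) ^ θ := h
    _ ≤ Gamma a ^ (1 - θ) * (Gamma a * M ^ k) ^ θ := by
        gcongr
        exact hk k le_rfl
    _ = Gamma a * M ^ (k * θ) := by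
        rw [mul_rpow hG.le (by positivity), ← mul_assoc, ← rpow_add hG, ← rpow_natCast,
          ← rpow_mul hM0.le]
        simp

theorem lintegral_comp_smul_pi {n : ℕ} (F : (Fin n → ℝ) → ENNReal) (hF : Measurable F) {t : ℝ}
    (ht : 0 < t) : ∫⁻ y, F y = ENNReal.ofReal (t ^ n) * ∫⁻ y, F (t • y) := by
  have h := Measure.map_addHaar_smul (volume : Measure (Fin n → ℝ)) ht.ne'
  rw [← lintegral_map hF (measurable_const_smul t), h, lintegral_smul_measure, smul_eq_mul,
    ← mul_assoc, ← ENNReal.ofReal_mul (by positivity)]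
  simp only [Module.finrank_fintype_fun_eq_card, Fintype.card_fin]
  rw [abs_of_pos (by positivity), mul_inv_cancel₀ (by positivity)]
  simp

theorem measurableSet_pball (p : ℝ) (n : ℕ) (r : ℝ) : MeasurableSet (pball p n r) :=
  measurableSet_le (by fun_prop) measurable_const

theorem mem_pball_one {p : ℝ} (hp : 1 ≤ p) {n : ℕ} (x : Fin n → ℝ) :
    x ∈ pball p n 1 ↔ ∑ i, |x i| ^ p ≤ 1 := by
  have h0 : 0 ≤ ∑ i, |x i| ^ p := Finset.sum_nonneg fun i _ => by positivity
  rw [pball, Set.mem_ofPred_eq]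
  constructor
  · intro h
    by_contra! hlt
    exact absurd h (not_le.2 (Real.one_lt_rpow hlt (by positivity)))
  · exact fun h => Real.rpow_le_one h0 h (by positivity)

theorem lintegral_mul_exp_neg {p : ℝ} (hp : 1 ≤ p) {n : ℕ} (hn : 0 < n) (k : ℕ)
    (F : (Fin n → ℝ) → ENNReal) (hF : Measurable F)
    (hom : ∀ t : ℝ, 0 < t → ∀ x, F (t • x) = ENNReal.ofReal (t ^ k) * F x) :
    ∫⁻ y, F y * ENNReal.ofReal (Real.exp (-∑ i, |y i| ^ p)) =
      ENNReal.ofReal (Real.Gamma ((n + k) / p + 1)) * ∫⁻ y in pball p n 1, F y := by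
  have hp0 : 0 < p := by linarith
  have hexp : ∀ s : ℝ, 0 ≤ s → ENNReal.ofReal (Real.exp (-s)) =
      ∫⁻ u in Set.Ioi (0 : ℝ), (Set.Ici s).indicator (fun u => ENNReal.ofReal (Real.exp (-u))) u := by
    intro s hs
    rw [setLIntegral_congr (Ioi_ae_eq_Ici (a := (0 : ℝ))), lintegral_indicator measurableSet_Ici,
      Measure.restrict_restrict measurableSet_Ici, Set.Ici_inter_Ici, sup_of_le_left hs,
      ← setLIntegral_congr (Ioi_ae_eq_Ici (a := s)), ← integral_exp_neg_Ioi s,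
      ofReal_integral_eq_lintegral_ofReal (integrableOn_exp_neg_Ioi s)
        (Filter.Eventually.of_forall fun _ => (Real.exp_pos _).le)]
  have hN : ∀ y : Fin n → ℝ, 0 ≤ ∑ i, |y i| ^ p :=
    fun y => Finset.sum_nonneg fun i _ => by positivity
  have hNm : Measurable fun y : Fin n → ℝ => ∑ i, |y i| ^ p := by fun_prop
  have hmeas : Measurable fun z : (Fin n → ℝ) × ℝ =>
      F z.1 * (Set.Ici (∑ i, |z.1 i| ^ p)).indicator
        (fun u => ENNReal.ofReal (Real.exp (-u))) z.2 := by
    refine (hF.comp measurable_fst).mul ?_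
    exact Measurable.indicator (s := {z : (Fin n → ℝ) × ℝ | ∑ i, |z.1 i| ^ p ≤ z.2})
      (f := fun z => ENNReal.ofReal (Real.exp (-z.2))) (by fun_prop)
      (measurableSet_le (hNm.comp measurable_fst) measurable_snd)
  have hscale : ∀ u : ℝ, 0 < u →
      ∫⁻ y, F y * (Set.Ici (∑ i, |y i| ^ p)).indicator
        (fun u => ENNReal.ofReal (Real.exp (-u))) u =
      ENNReal.ofReal (Real.exp (-u) * u ^ ((n + k) / p)) * ∫⁻ y in pball p n 1, F y := by
    intro u hu
    have ht : 0 < u ^ (1 / p) := by positivity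
    rw [lintegral_comp_smul_pi _ ?_ ht]
    · have h1 : ∀ y : Fin n → ℝ, F (u ^ (1 / p) • y) *
          (Set.Ici (∑ i, |(u ^ (1 / p) • y) i| ^ p)).indicator
            (fun u => ENNReal.ofReal (Real.exp (-u))) u =
          ENNReal.ofReal ((u ^ (1 / p)) ^ k) * ENNReal.ofReal (Real.exp (-u)) *
            (pball p n 1).indicator F y := by
        intro y
        have h2 : ∑ i, |(u ^ (1 / p) • y) i| ^ p = u * ∑ i, |y i| ^ p := by
          rw [Finset.mul_sum]
          refine Finset.sum_congr rfl fun i _ => ?_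
          rw [Pi.smul_apply, smul_eq_mul, abs_mul, Real.mul_rpow (abs_nonneg _) (abs_nonneg _),
            abs_of_pos ht, ← Real.rpow_mul hu.le]
          simp [hp0.ne']
        rw [h2, hom _ ht]
        by_cases hy : ∑ i, |y i| ^ p ≤ 1
        · rw [Set.indicator_of_mem ((mem_pball_one hp y).2 hy), Set.indicator_of_mem]
          · ring
          · rw [Set.mem_Ici]; nlinarith
        · rw [Set.indicator_of_notMem (mt (mem_pball_one hp y).1 hy), Set.indicator_of_notMem]
          · simp
          · rw [Set.mem_Ici]; push Not at hy ⊢; nlinarith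
      simp only [h1]
      rw [lintegral_const_mul _ (hF.indicator (measurableSet_pball p n 1)),
        lintegral_indicator (measurableSet_pball p n 1), ← mul_assoc, ← mul_assoc,
        ← ENNReal.ofReal_mul (by positivity), ← ENNReal.ofReal_mul (by positivity)]
      congr 2
      rw [← Real.rpow_natCast, ← Real.rpow_natCast, ← Real.rpow_mul hu.le, ← Real.rpow_mul hu.le,
        ← Real.rpow_add hu, mul_comm]
      congr 2
      field_simp
    · exact hmeas.comp (measurable_id.prodMk measurable_const)
  calc _ = ∫⁻ y, ∫⁻ u in Set.Ioi (0 : ℝ), F y * (Set.Ici (∑ i, |y i| ^ p)).indicator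
        (fun u => ENNReal.ofReal (Real.exp (-u))) u := by
        refine lintegral_congr fun y => ?_
        rw [hexp _ (hN y), lintegral_const_mul _ (Measurable.indicator (by fun_prop) measurableSet_Ici)]
    _ = ∫⁻ u in Set.Ioi (0 : ℝ), ∫⁻ y, F y * (Set.Ici (∑ i, |y i| ^ p)).indicator
        (fun u => ENNReal.ofReal (Real.exp (-u))) u := by
        refine lintegral_lintegral_swap hmeas.aemeasurable
    _ = ∫⁻ u in Set.Ioi (0 : ℝ), ENNReal.ofReal (Real.exp (-u) * u ^ ((n + k) / p)) *
          ∫⁻ y in pball p n 1, F y :=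
        setLIntegral_congr_fun measurableSet_Ioi fun u hu => hscale u hu
    _ = _ := by
        rw [lintegral_mul_const _ (by fun_prop), Real.Gamma_eq_integral (by positivity),
          ofReal_integral_eq_lintegral_ofReal]
        · simp
        · exact Real.GammaIntegral_convergent (by positivity)
        · refine (ae_restrict_iff' measurableSet_Ioi).2 (Filter.Eventually.of_forall fun u hu => ?_)
          have : 0 < u := hu
          simp only [Pi.zero_apply]
          positivity

theorem integrable_eval_mul_exp_neg {p : ℝ} (hp : 0 < p) (q : Polynomial ℝ) :
    Integrable fun y : ℝ => q.eval y * Real.exp (-|y| ^ p) := by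
  induction q using Polynomial.induction_on' with
  | add a b ha hb =>
    simp only [Polynomial.eval_add, add_mul]
    exact ha.add hb
  | monomial k c =>
    have h1 : Integrable fun y : ℝ => ‖y‖ ^ k * Real.exp (-‖y‖ ^ p) := by
      refine (integrable_fun_norm_addHaar (volume : Measure ℝ)
        (f := fun y : ℝ => y ^ k * Real.exp (-y ^ p))).2 ?_
      simpa using integrableOn_rpow_mul_exp_neg_rpow (s := k)
        (by have : (0 : ℝ) ≤ k := by positivity
            linarith) hp
    refine (h1.const_mul |c|).mono ((Polynomial.continuous _).measurable.mul
      (by fun_prop : Measurable fun y : ℝ => Real.exp (-|y| ^ p))).aestronglyMeasurable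
      (Filter.Eventually.of_forall fun y => ?_)
    simp [mul_assoc]

theorem integrable_eval_mul_prod_exp_neg {p : ℝ} (hp : 0 < p) {n : ℕ}
    (F : MvPolynomial (Fin n) ℝ) :
    Integrable fun y : Fin n → ℝ => MvPolynomial.eval y F * ∏ i, Real.exp (-|y i| ^ p) := by
  induction F using MvPolynomial.induction_on' with
  | add a b ha hb =>
    simp only [map_add, add_mul]
    exact ha.add hb
  | monomial m c =>
    have h := (Integrable.fintype_prod (μ := fun _ => (volume : Measure ℝ)) fun i : Fin n =>
      integrable_eval_mul_exp_neg hp (Polynomial.X ^ m i)).const_mul c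
    simpa [MvPolynomial.eval_monomial, Finsupp.prod_fintype, Finset.prod_mul_distrib, mul_assoc,
      volume_pi] using h

theorem integral_exp_neg_abs_rpow_mem {p : ℝ} (hp : 1 ≤ p) :
    0 < ∫ y : ℝ, Real.exp (-|y| ^ p) ∧ ∫ y : ℝ, Real.exp (-|y| ^ p) ≤ 2 := by
  have hp0 : 0 < p := by linarith
  rw [integral_comp_abs (f := fun y => Real.exp (-y ^ p)), integral_exp_neg_rpow hp0]
  have h1 : Real.Gamma (1 + ((1 : ℕ) : ℝ) * (1 / p)) ≤ 1 := by
    have := Gamma_add_le one_pos (θ := 1 / p) (by positivity) ((div_le_one hp0).2 hp) 1 one_pos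
      (by simp)
    simpa using this
  have h2 : 0 < Real.Gamma (1 / p + 1) := Real.Gamma_pos_of_pos (by positivity)
  rw [Nat.cast_one, one_mul, add_comm] at h1
  constructor <;> linarith

open Polynomial in
theorem integral_sq_pos_of_ne_zero {q : ℝ[X]} (hq : q ≠ 0) :
    0 < ∫ y in (-1 : ℝ)..1, (q * q).eval y := by
  refine intervalIntegral.integral_pos (by norm_num) (q * q).continuous.continuousOn
    (fun y _ => by rw [eval_mul]; exact mul_self_nonneg _) ?_
  by_contra! h
  refine hq (eq_zero_of_infinite_isRoot q ((Set.Icc_infinite (show (-1 : ℝ) < 1 by norm_num)).mono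
    fun y hy => ?_))
  have := h y hy
  rw [eval_mul] at this
  exact mul_self_eq_zero.1 (le_antisymm this (mul_self_nonneg _))

open Polynomial in
theorem exists_le_integral_sq_of_monic (d : ℕ) : ∃ κ : ℝ, 0 < κ ∧ ∀ k ≤ d, ∀ q : ℝ[X],
    q.Monic → q.natDegree = k → κ ≤ ∫ y in (-1 : ℝ)..1, (q * q).eval y := by
  let L : ℝ[X] →ₗ[ℝ] ℝ :=
    { toFun := fun q => ∫ y in (-1 : ℝ)..1, q.eval y
      map_add' := fun a b => by
        simp only [eval_add]
        exact intervalIntegral.integral_add (a.continuous.intervalIntegrable _ _)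
          (b.continuous.intervalIntegrable _ _)
      map_smul' := fun c a => by simp }
  have hL : ∀ q ≠ 0, 0 < L (q * q) := fun q hq => integral_sq_pos_of_ne_zero hq
  have hL' : ∀ q, 0 ≤ L (q * q) := fun q => by
    rcases eq_or_ne q 0 with rfl | h
    · simp
    · exact (hL q h).le
  choose h hm hd ho using exists_monic_orthogonal L hL
  obtain ⟨k₀, -, hk₀⟩ := (Finset.range (d + 1)).exists_min_image (fun k => L (h k * h k)) ⟨0, by simp⟩
  exact ⟨L (h k₀ * h k₀), hL _ (hm _).ne_zero, fun k hk q qm qd =>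
    (hk₀ k (by simpa [Nat.lt_succ_iff] using hk)).trans
      (le_of_monic_orthogonal L hL' (hm k) (hd k) (ho k) qm qd)⟩

open Polynomial in
theorem exp_neg_one_mul_integral_sq_le {p : ℝ} (hp : 0 < p) (q : ℝ[X]) :
    Real.exp (-1) * ∫ y in (-1 : ℝ)..1, (q * q).eval y ≤
      ∫ y : ℝ, (q * q).eval y * Real.exp (-|y| ^ p) := by
  have hI := integrable_eval_mul_exp_neg hp (q * q)
  rw [intervalIntegral.integral_of_le (by norm_num), ← integral_const_mul]
  refine le_trans (setIntegral_mono_on ?_ hI.integrableOn measurableSet_Ioc fun y hy => ?_)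
    (setIntegral_le_integral hI (Filter.Eventually.of_forall fun y => ?_))
  · exact (((q * q).continuous.intervalIntegrable (-1) 1).1).const_mul _
  · rw [mul_comm]
    have h1 : |y| ^ p ≤ 1 :=
      Real.rpow_le_one (abs_nonneg _) (abs_le.2 ⟨hy.1.le, hy.2⟩) hp.le
    refine mul_le_mul_of_nonneg_left (Real.exp_le_exp.2 (by linarith)) ?_
    rw [eval_mul]; exact mul_self_nonneg _
  · simp only [Pi.zero_apply, eval_mul]
    exact mul_nonneg (mul_self_nonneg _) (Real.exp_pos _).le

open Polynomial in
theorem exists_pow_mul_sum_sq_coeff_le_integral (d : ℕ) : ∃ c : ℝ, 0 < c ∧ ∀ p : ℝ, 1 ≤ p →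
    ∀ (n : ℕ) (f : MvPolynomial (Fin n) ℝ), f.IsHomogeneous d →
      c * (∑ m ∈ f.support, f.coeff m ^ 2) * (∫ y : ℝ, Real.exp (-|y| ^ p)) ^ n ≤
        ∫ y : Fin n → ℝ, MvPolynomial.eval y f ^ 2 * Real.exp (-∑ i, |y i| ^ p) := by
  obtain ⟨κ, κ0, hκ⟩ := exists_le_integral_sq_of_monic d
  refine ⟨min 1 (κ * (Real.exp (-1) / 2)) ^ d, by positivity, fun p hp n f hf => ?_⟩
  have hp0 : 0 < p := by linarith
  obtain ⟨Z0, Z2⟩ := integral_exp_neg_abs_rpow_mem hp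
  set Z := ∫ y : ℝ, Real.exp (-|y| ^ p) with hZ
  let L : ℝ[X] →ₗ[ℝ] ℝ :=
    { toFun := fun q => Z⁻¹ * ∫ y, q.eval y * Real.exp (-|y| ^ p)
      map_add' := fun a b => by
        simp only [eval_add, add_mul]
        rw [integral_add (integrable_eval_mul_exp_neg hp0 a) (integrable_eval_mul_exp_neg hp0 b),
          mul_add]
      map_smul' := fun c a => by
        simp only [eval_smul, smul_eq_mul, mul_assoc, integral_const_mul, RingHom.id_apply]
        ring }
  let E : MvPolynomial (Fin n) ℝ →ₗ[ℝ] ℝ :=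
    { toFun := fun F => (Z ^ n)⁻¹ * ∫ y, MvPolynomial.eval y F * ∏ i, Real.exp (-|y i| ^ p)
      map_add' := fun a b => by
        simp only [map_add, add_mul]
        rw [integral_add (integrable_eval_mul_prod_exp_neg hp0 a)
          (integrable_eval_mul_prod_exp_neg hp0 b), mul_add]
      map_smul' := fun c a => by
        simp only [MvPolynomial.smul_eval, smul_eq_mul, mul_assoc, integral_const_mul,
          RingHom.id_apply]
        ring }
  have hle : ∀ q : ℝ[X], (Real.exp (-1) / 2) * ∫ y in (-1 : ℝ)..1, (q * q).eval y ≤ L (q * q) := by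
    intro q
    have h1 := exp_neg_one_mul_integral_sq_le hp0 q
    have h2 : 0 ≤ ∫ y in (-1 : ℝ)..1, (q * q).eval y :=
      intervalIntegral.integral_nonneg (by norm_num) fun y _ => by
        rw [eval_mul]; exact mul_self_nonneg _
    calc _ = 2⁻¹ * (Real.exp (-1) * ∫ y in (-1 : ℝ)..1, (q * q).eval y) := by ring
      _ ≤ Z⁻¹ * ∫ y, (q * q).eval y * Real.exp (-|y| ^ p) := by gcongr
  have key := pow_mul_sum_sq_coeff_le L
    (fun q hq => lt_of_lt_of_le (mul_pos (by positivity) (integral_sq_pos_of_ne_zero hq)) (hle q))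
    (by simp [L, ← hZ, Z0.ne']) (κ := min 1 (κ * (Real.exp (-1) / 2))) (by positivity)
    (min_le_left _ _)
    (fun k hk q qm qd => (min_le_right _ _).trans (le_trans (by
      rw [mul_comm]
      exact mul_le_mul_of_nonneg_left (hκ k hk q qm qd) (by positivity)) (hle q)))
    E (fun q => ?_) (fun F => ?_) hf
  · change _ ≤ (Z ^ n)⁻¹ * _ at key
    rw [inv_mul_eq_div, le_div_iff₀ (by positivity)] at key
    simpa [sq, ← Real.exp_sum] using key
  · simp only [E, L, LinearMap.coe_mk, AddHom.coe_mk, Finset.prod_mul_distrib, Finset.prod_const,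
      Finset.card_univ, Fintype.card_fin, inv_pow]
    rw [← integral_fintype_prod_volume_eq_prod (fun i y => (q i).eval y * Real.exp (-|y| ^ p))]
    congr 2 with y
    rw [Finset.prod_mul_distrib, map_prod]
    congr 2 with i
    rw [← MvPolynomial.coe_aeval_eq_eval, RingHom.coe_coe, ← aeval_algHom_apply,
      MvPolynomial.aeval_X]
    simp [aeval_def, eval₂_eq_eval_map]
  · simp only [E, LinearMap.coe_mk, AddHom.coe_mk, map_mul]
    refine mul_nonneg (by positivity) (integral_nonneg fun y => ?_)
    exact mul_nonneg (mul_self_nonneg _) (by positivity)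

theorem integral_mul_exp_neg {p : ℝ} (hp : 1 ≤ p) {n : ℕ} (hn : 0 < n) (k : ℕ)
    (F : (Fin n → ℝ) → ℝ) (hF : Measurable F) (hF0 : ∀ x, 0 ≤ F x)
    (hom : ∀ t : ℝ, 0 < t → ∀ x, F (t • x) = t ^ k * F x) :
    ∫ y, F y * Real.exp (-∑ i, |y i| ^ p) =
      Real.Gamma ((n + k) / p + 1) * ∫ y in pball p n 1, F y := by
  have h := lintegral_mul_exp_neg hp hn k (fun y => ENNReal.ofReal (F y)) hF.ennreal_ofReal
    (fun t ht x => by rw [hom t ht, ENNReal.ofReal_mul (by positivity)])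
  have hG : 0 ≤ Real.Gamma ((n + k) / p + 1) := (Real.Gamma_pos_of_pos (by positivity)).le
  rw [integral_eq_lintegral_of_nonneg_ae
      (Filter.Eventually.of_forall fun y => mul_nonneg (hF0 y) (Real.exp_pos _).le) (by fun_prop),
    integral_eq_lintegral_of_nonneg_ae (Filter.Eventually.of_forall hF0) (by fun_prop)]
  simp only [ENNReal.ofReal_mul (hF0 _)]
  rw [h, ENNReal.toReal_mul, ENNReal.toReal_ofReal hG]

theorem MvPolynomial.IsHomogeneous.sum_coeff_sq_eq {n d : ℕ} {f : MvPolynomial (Fin n) ℝ}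
    (hf : f.IsHomogeneous d) : ∑ m ∈ f.support, f.coeff m ^ 2 = coeffd d f ^ 2 := by
  rw [coeffd, Real.sq_sqrt (Finset.sum_nonneg fun _ _ => sq_nonneg _),
    Finset.filter_true_of_mem]
  exact fun m hm => hf.sum_eq_of_mem_support hm

theorem MvPolynomial.IsHomogeneous.eval_real_smul {n d : ℕ} {f : MvPolynomial (Fin n) ℝ}
    (hf : f.IsHomogeneous d) (t : ℝ) (x : Fin n → ℝ) :
    MvPolynomial.eval (t • x) f = t ^ d * MvPolynomial.eval x f := by
  rw [MvPolynomial.eval_eq', MvPolynomial.eval_eq', Finset.mul_sum]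
  refine Finset.sum_congr rfl fun m hm => ?_
  simp only [Pi.smul_apply, smul_eq_mul, mul_pow, Finset.prod_mul_distrib,
    Finset.prod_pow_eq_pow_sum, hf.sum_eq_of_mem_support hm]
  ring

/-- second-moment lower bound for homogeneous polynomials on the unit `L_p`
ball, with the dimensional factor `n^{-2d/p}`. -/
theorem stmt12 (d : ℕ) :
    ∃ C > 0, ∀ (p : ℝ), 1 ≤ p → ∀ n : ℕ, 16 * d ^ 2 < n →
      ∀ f : MvPolynomial (Fin n) ℝ, f.IsHomogeneous d →
        ∫ x, (MvPolynomial.eval x f) ^ 2 ∂(unif (pball p n 1)) ≥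
          C * (n : ℝ) ^ (-(2 * (d : ℝ)) / p) * coeffd d f ^ 2 := by
  obtain ⟨c, c0, hc⟩ := exists_pow_mul_sum_sq_coeff_le_integral d
  refine ⟨c / (2 + 2 * d) ^ (2 * d), by positivity, fun p hp n hn f hf => ?_⟩
  have hp0 : 0 < p := by linarith
  have hn0 : 0 < n := by omega
  have hn1 : (1 : ℝ) ≤ n := by exact_mod_cast hn0
  have key := hc p hp n f hf
  rw [hf.sum_coeff_sq_eq] at key
  have hf2 := integral_mul_exp_neg hp hn0 (2 * d) (fun y => MvPolynomial.eval y f ^ 2)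
    (f.continuous_eval.pow 2).measurable (fun _ => sq_nonneg _) (fun t _ x => by
      rw [hf.eval_real_smul, mul_pow, ← pow_mul, mul_comm d])
  have h1 := integral_mul_exp_neg hp hn0 0 (fun _ => 1) measurable_const (fun _ => zero_le_one)
    (by simp)
  obtain ⟨Z0, -⟩ := integral_exp_neg_abs_rpow_mem hp
  have hZ : ∫ y : Fin n → ℝ, Real.exp (-∑ i, |y i| ^ p) = (∫ y : ℝ, Real.exp (-|y| ^ p)) ^ n := by
    have := integral_fintype_prod_volume_eq_pow (ι := Fin n) (fun y : ℝ => Real.exp (-|y| ^ p))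
    simpa [← Real.exp_sum] using this
  simp only [one_mul, hZ, integral_const, smul_eq_mul, mul_one, Nat.cast_zero, add_zero,
    measureReal_restrict_apply_univ] at h1
  rw [hf2, h1] at key
  have hG1 : 0 < Real.Gamma (n / p + 1) := Real.Gamma_pos_of_pos (by positivity)
  have hV : 0 < volume.real (pball p n 1) := by
    have : 0 < Real.Gamma (n / p + 1) * volume.real (pball p n 1) := by rw [← h1]; positivity
    exact (mul_pos_iff_of_pos_left hG1).1 this
  have hG2 : Real.Gamma ((n + (2 * d : ℕ)) / p + 1) ≤
      Real.Gamma (n / p + 1) * ((2 + 2 * d) ^ (2 * d) * (n : ℝ) ^ (2 * d / p)) := by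
    have hnp : (n : ℝ) / p ≤ n := div_le_self (by positivity) hp
    have h := Gamma_add_le (a := n / p + 1) (θ := 1 / p) (by positivity) (by positivity)
      ((div_le_one hp0).2 hp) (2 * d) (M := (2 + 2 * d) * n) (by positivity) (by
        push_cast
        nlinarith [show (0 : ℝ) ≤ d by positivity])
    have e1 : (n + (2 * d : ℕ)) / p + 1 = (n : ℝ) / p + 1 + (2 * d : ℕ) * (1 / p) := by ring
    rw [e1]
    refine h.trans (mul_le_mul_of_nonneg_left ?_ hG1.le)
    have e2 : ((2 * d : ℕ) : ℝ) * (1 / p) = 2 * d / p := by push_cast; ring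
    rw [e2, Real.mul_rpow (by positivity) (by positivity)]
    refine mul_le_mul_of_nonneg_right ?_ (by positivity)
    rw [← Real.rpow_natCast]
    refine Real.rpow_le_rpow_of_exponent_le ?_ ?_
    · linarith [show (0 : ℝ) ≤ d by positivity]
    · push_cast
      exact div_le_self (by positivity) hp
  have hI : 0 ≤ ∫ y in pball p n 1, MvPolynomial.eval y f ^ 2 :=
    integral_nonneg fun _ => sq_nonneg _
  have hfin := key.trans (mul_le_mul_of_nonneg_right hG2 hI)
  rw [unif, integral_smul_measure, ENNReal.toReal_inv, smul_eq_mul, ge_iff_le, ← Measure.real,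
    inv_mul_eq_div, le_div_iff₀ hV, neg_div, Real.rpow_neg (by positivity)]
  have hR : 0 < (n : ℝ) ^ (2 * d / p) := by positivity
  have hK : (0 : ℝ) < (2 + 2 * d) ^ (2 * d) := by positivity
  have : c * coeffd d f ^ 2 * volume.real (pball p n 1) ≤
      ((2 + 2 * d) ^ (2 * d) * (n : ℝ) ^ (2 * d / p)) *
        ∫ y in pball p n 1, MvPolynomial.eval y f ^ 2 := by
    refine le_of_mul_le_mul_left ?_ hG1
    linarith
  calc _ = c * coeffd d f ^ 2 * volume.real (pball p n 1) /
        ((2 + 2 * d) ^ (2 * d) * (n : ℝ) ^ (2 * d / p)) := by field_simp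
    _ ≤ _ := (div_le_iff₀' (by positivity)).2 this
end

section
/- Let n ≥ 2, d ∈ ℕ, and let f, g be homogeneous polynomials of degree d on ℝⁿ that are harmonic. Then ∫_{S^{n−1}} f·g dσ = γ_{d,n} · ⟨f,g⟩_B, where σ is the rotation-invariant (uniform) probability measure on the unit sphere S^{n−1} ⊂ ℝⁿ and γ_{d,n} = 1/(n(n+2)(n+4)···(n+2d−2)) = (Π_{j=0}^{d−1}(n+2j))^{−1}. -/
open MeasureTheory

/-- A multivariate polynomial is harmonic if its Laplacian (the sum of its second formal
partial derivatives) vanishes. -/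
def IsHarmonic {n : ℕ} (f : MvPolynomial (Fin n) ℝ) : Prop :=
  ∑ j, MvPolynomial.pderiv j (MvPolynomial.pderiv j f) = 0

/-- The Bombieri inner product of two homogeneous polynomials of degree `d`:
`⟨f,g⟩_B = ∑_{|I|=d} I! a_I b_I`. -/
noncomputable def bombieri {n : ℕ} (f g : MvPolynomial (Fin n) ℝ) : ℝ :=
  ∑ m ∈ f.support, (∏ i, ((m i).factorial : ℝ)) * f.coeff m * g.coeff m

open MvPolynomial in
/-- Partial derivatives of polynomials commute. -/
theorem pderiv_pderiv_comm {ι : Type*} {R : Type*} [CommSemiring R] (i j : ι)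
    (p : MvPolynomial ι R) : pderiv i (pderiv j p) = pderiv j (pderiv i p) := by
  classical
  ext m
  simp only [coeff_pderiv, Finsupp.add_apply, Finsupp.single_apply]
  rw [add_right_comm m]
  by_cases h : i = j
  · subst h; rfl
  · simp [h, Ne.symm h]
    ring

theorem IsHarmonic.pderiv {n : ℕ} {f : MvPolynomial (Fin n) ℝ} (hf : IsHarmonic f) (i : Fin n) :
    IsHarmonic (MvPolynomial.pderiv i f) := by
  have h := congrArg (MvPolynomial.pderiv i) hf
  rw [map_sum, map_zero] at h
  rw [IsHarmonic, ← h]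
  refine Finset.sum_congr rfl fun j _ => ?_
  rw [pderiv_pderiv_comm j i f, pderiv_pderiv_comm j i]

section Bombieri

open MvPolynomial

variable {n : ℕ}

theorem bombieri_eq_sum_of_support_subset (f g : MvPolynomial (Fin n) ℝ)
    (s : Finset (Fin n →₀ ℕ)) (hs : f.support ⊆ s) :
    bombieri f g = ∑ m ∈ s, (∏ i, ((m i).factorial : ℝ)) * f.coeff m * g.coeff m := by
  refine Finset.sum_subset hs fun m _ hm => ?_
  rw [notMem_support_iff.mp hm, mul_zero, zero_mul]

theorem bombieri_add_left (f₁ f₂ g : MvPolynomial (Fin n) ℝ) :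
    bombieri (f₁ + f₂) g = bombieri f₁ g + bombieri f₂ g := by
  classical
  rw [bombieri_eq_sum_of_support_subset _ g _ support_add,
    bombieri_eq_sum_of_support_subset f₁ g _ Finset.subset_union_left,
    bombieri_eq_sum_of_support_subset f₂ g _ Finset.subset_union_right, ← Finset.sum_add_distrib]
  refine Finset.sum_congr rfl fun m _ => ?_
  rw [coeff_add]
  ring

theorem bombieri_monomial_left (m : Fin n →₀ ℕ) (a : ℝ) (g : MvPolynomial (Fin n) ℝ) :
    bombieri (monomial m a) g = (∏ i, ((m i).factorial : ℝ)) * a * g.coeff m := by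
  classical
  rw [bombieri_eq_sum_of_support_subset _ g {m} support_monomial_subset]
  simp

theorem bombieri_sum_right {ι : Type*} (s : Finset ι) (f : MvPolynomial (Fin n) ℝ)
    (g : ι → MvPolynomial (Fin n) ℝ) : bombieri f (∑ i ∈ s, g i) = ∑ i ∈ s, bombieri f (g i) := by
  simp only [bombieri, coeff_sum, Finset.mul_sum]
  rw [Finset.sum_comm]

theorem bombieri_nsmul_right (d : ℕ) (f g : MvPolynomial (Fin n) ℝ) :
    bombieri f (d • g) = d * bombieri f g := by
  simp only [bombieri, coeff_smul, Finset.mul_sum]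
  refine Finset.sum_congr rfl fun m _ => ?_
  rw [nsmul_eq_mul]
  ring

/-- Differentiation is adjoint to multiplication by a variable for the Bombieri inner product. -/
theorem bombieri_pderiv_left (j : Fin n) (f g : MvPolynomial (Fin n) ℝ) :
    bombieri (pderiv j f) g = bombieri f (X j * g) := by
  classical
  induction f using MvPolynomial.induction_on' with
  | monomial m a =>
    rw [pderiv_monomial, bombieri_monomial_left, bombieri_monomial_left, coeff_X_mul']
    by_cases hj : m j = 0
    · simp [hj]
    · rw [if_pos (Finsupp.mem_support_iff.mpr hj)]
      have hprod : (∏ i, ((m i).factorial : ℝ)) =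
          (∏ i, (((m - Finsupp.single j 1 : Fin n →₀ ℕ) i).factorial : ℝ)) * m j := by
        rw [← Finset.mul_prod_erase _ _ (Finset.mem_univ j),
          ← Finset.mul_prod_erase Finset.univ
            (fun i => (((m - Finsupp.single j 1 : Fin n →₀ ℕ) i).factorial : ℝ)) (Finset.mem_univ j)]
        have herase : ∏ i ∈ Finset.univ.erase j, (((m - Finsupp.single j 1 : Fin n →₀ ℕ) i).factorial : ℝ) =
            ∏ i ∈ Finset.univ.erase j, ((m i).factorial : ℝ) := by
          refine Finset.prod_congr rfl fun i hi => ?_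
          simp [(Finset.ne_of_mem_erase hi).symm]
        rw [herase, ← Nat.mul_factorial_pred hj]
        simp
        ring
      rw [hprod]
      ring
  | add p q hp hq => rw [map_add, bombieri_add_left, bombieri_add_left, hp, hq]

theorem sum_bombieri_pderiv {d : ℕ} (f : MvPolynomial (Fin n) ℝ) {g : MvPolynomial (Fin n) ℝ}
    (hg : g.IsHomogeneous d) :
    ∑ j, bombieri (pderiv j f) (pderiv j g) = d * bombieri f g := by
  simp only [bombieri_pderiv_left]
  rw [← bombieri_sum_right, hg.sum_X_mul_pderiv, bombieri_nsmul_right]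

end Bombieri

section Rotation

open MvPolynomial Matrix

variable {n : ℕ}

/-- The matrix of the rotation by the angle `t` in the oriented plane spanned by the `i`-th and
`j`-th standard basis vectors. -/
noncomputable def planeRotation (i j : Fin n) (t : ℝ) : Matrix (Fin n) (Fin n) ℝ :=
  Matrix.of fun k =>
    if k = i then Real.cos t • Pi.single i 1 - Real.sin t • Pi.single j 1
    else if k = j then Real.sin t • Pi.single i 1 + Real.cos t • Pi.single j 1
    else Pi.single k 1

theorem planeRotation_mulVec (i j : Fin n) (t : ℝ) (x : Fin n → ℝ) (k : Fin n) :
    (planeRotation i j t *ᵥ x) k =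
      if k = i then Real.cos t * x i - Real.sin t * x j
      else if k = j then Real.sin t * x i + Real.cos t * x j
      else x k := by
  simp only [Matrix.mulVec, planeRotation, Matrix.of_apply]
  split_ifs <;> simp only [sub_dotProduct, add_dotProduct, smul_dotProduct,
    single_one_dotProduct, smul_eq_mul]

theorem planeRotation_zero_mulVec (i j : Fin n) (x : Fin n → ℝ) :
    planeRotation i j 0 *ᵥ x = x := by
  ext k
  rw [planeRotation_mulVec]
  split_ifs with hi hj <;> simp [*]

theorem planeRotation_mem_orthogonalGroup {i j : Fin n} (hij : i ≠ j) (t : ℝ) :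
    planeRotation i j t ∈ Matrix.orthogonalGroup (Fin n) ℝ := by
  rw [Matrix.mem_orthogonalGroup_iff]
  change planeRotation i j t * (planeRotation i j t)ᵀ = 1
  ext k l
  have hmul : (planeRotation i j t * (planeRotation i j t)ᵀ) k l =
      (planeRotation i j t *ᵥ fun m => planeRotation i j t l m) k := by
    simp [Matrix.mul_apply, Matrix.mulVec, dotProduct]
  rw [hmul, planeRotation_mulVec, Matrix.one_apply]
  clear hmul
  by_cases hki : k = i <;> by_cases hkj : k = j <;> by_cases hli : l = i <;>
    by_cases hlj : l = j <;>
    simp_all [planeRotation, Pi.single_apply, eq_comm] <;>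
    first | ring1 | linear_combination -Real.sin_sq_add_cos_sq t

/-- The infinitesimal rotation `x_i ∂_j - x_j ∂_i`. -/
noncomputable def angularDeriv (i j : Fin n) :
    Derivation ℝ (MvPolynomial (Fin n) ℝ) (MvPolynomial (Fin n) ℝ) :=
  (X i : MvPolynomial (Fin n) ℝ) • pderiv j - (X j : MvPolynomial (Fin n) ℝ) • pderiv i

theorem angularDeriv_apply (i j : Fin n) (p : MvPolynomial (Fin n) ℝ) :
    angularDeriv i j p = X i * pderiv j p - X j * pderiv i p := by
  simp [angularDeriv]

theorem hasDerivAt_eval_planeRotation_mulVec {i j : Fin n} (hij : i ≠ j) (x : Fin n → ℝ)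
    (p : MvPolynomial (Fin n) ℝ) (t : ℝ) :
    HasDerivAt (fun t => eval (planeRotation i j t *ᵥ x) p)
      (eval (planeRotation i j t *ᵥ x) (angularDeriv i j p)) t := by
  induction p using MvPolynomial.induction_on with
  | C a => simpa [angularDeriv_apply] using hasDerivAt_const t a
  | add p q hp hq => simpa using hp.fun_add hq
  | mul_X p k hp =>
    have hX : HasDerivAt (fun t => (planeRotation i j t *ᵥ x) k)
        (eval (planeRotation i j t *ᵥ x) (angularDeriv i j (X k))) t := by
      simp only [angularDeriv_apply, pderiv_X, map_sub, map_mul, eval_X]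
      have hc := Real.hasDerivAt_cos t
      have hs := Real.hasDerivAt_sin t
      by_cases hki : k = i
      · subst hki
        simp only [planeRotation_mulVec, if_true, hij.symm, if_false, Pi.single_apply, hij]
        convert! (hc.mul_const (x k)).sub (hs.mul_const (x j)) using 1
        simp
        ring
      · by_cases hkj : k = j
        · subst hkj
          simp only [planeRotation_mulVec, if_true, hij.symm, if_false, Pi.single_apply]
          convert! (hs.mul_const (x i)).add (hc.mul_const (x k)) using 1
          simp
          ring
        · simpa [planeRotation_mulVec, hki, hkj, Pi.single_apply] using hasDerivAt_const t (x k)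
    convert! hp.mul hX using 1
    · ext s
      simp
    · simp [Derivation.leibniz]
      ring

end Rotation

section Sphere

open MvPolynomial Matrix

variable {n : ℕ}

theorem isCompact_setOf_sum_sq_eq_one : IsCompact {x : Fin n → ℝ | ∑ i, (x i) ^ 2 = 1} := by
  refine (isCompact_closedBall (0 : Fin n → ℝ) 1).of_isClosed_subset
    (isClosed_eq (by fun_prop) continuous_const) fun x hx => ?_
  rw [mem_closedBall_zero_iff, pi_norm_le_iff_of_nonneg zero_le_one]
  intro i
  rw [Real.norm_eq_abs, ← sq_le_one_iff_abs_le_one, ← (hx : ∑ i, (x i) ^ 2 = 1)]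
  exact Finset.single_le_sum (f := fun i => (x i) ^ 2) (fun i _ => sq_nonneg _)
    (Finset.mem_univ i)

theorem sum_sq_mulVec_of_mem_orthogonalGroup {A : Matrix (Fin n) (Fin n) ℝ}
    (hA : A ∈ Matrix.orthogonalGroup (Fin n) ℝ) (x : Fin n → ℝ) :
    ∑ i, ((A *ᵥ x) i) ^ 2 = ∑ i, (x i) ^ 2 := by
  have h : (A *ᵥ x) ⬝ᵥ (A *ᵥ x) = x ⬝ᵥ x := by
    have hA' : Aᵀ * A = 1 := (Matrix.mem_orthogonalGroup_iff' (Fin n) ℝ).mp hA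
    rw [Matrix.dotProduct_mulVec, Matrix.vecMul_mulVec, hA', Matrix.vecMul_one]
  simpa [dotProduct, sq] using h

variable {σ : Measure (Fin n → ℝ)} [IsProbabilityMeasure σ]

theorem ae_sum_sq_eq_one (hsphere : σ {x | ∑ i, (x i) ^ 2 = 1} = 1) :
    ∀ᵐ x ∂σ, ∑ i, (x i) ^ 2 = 1 :=
  (mem_ae_iff_prob_eq_one isCompact_setOf_sum_sq_eq_one.measurableSet).mpr hsphere

theorem exists_norm_eval_le_on_sphere (p : MvPolynomial (Fin n) ℝ) :
    ∃ C, ∀ x : Fin n → ℝ, ∑ i, (x i) ^ 2 = 1 → ‖eval x p‖ ≤ C :=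
  isCompact_setOf_sum_sq_eq_one.exists_bound_of_continuousOn p.continuous_eval.continuousOn

theorem integrable_eval (hsphere : σ {x | ∑ i, (x i) ^ 2 = 1} = 1)
    (p : MvPolynomial (Fin n) ℝ) : Integrable (fun x => eval x p) σ := by
  obtain ⟨C, hC⟩ := exists_norm_eval_le_on_sphere p
  exact Integrable.of_bound p.continuous_eval.aestronglyMeasurable C
    ((ae_sum_sq_eq_one hsphere).mono hC)

theorem integral_eval_angularDeriv (hsphere : σ {x | ∑ i, (x i) ^ 2 = 1} = 1)
    (hinv : ∀ A : Matrix (Fin n) (Fin n) ℝ, A ∈ Matrix.orthogonalGroup (Fin n) ℝ →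
      σ.map A.mulVec = σ) (i j : Fin n) (p : MvPolynomial (Fin n) ℝ) :
    ∫ x, eval x (angularDeriv i j p) ∂σ = 0 := by
  by_cases hij : i = j
  · simp [hij, angularDeriv_apply]
  obtain ⟨C, hC⟩ := exists_norm_eval_le_on_sphere (angularDeriv i j p)
  have hcont (t : ℝ) : Continuous (planeRotation i j t).mulVec :=
    continuous_const.matrix_mulVec continuous_id
  have hderiv := (hasDerivAt_integral_of_dominated_loc_of_deriv_le (μ := σ) (x₀ := (0 : ℝ))
    (F := fun t x => eval (planeRotation i j t *ᵥ x) p)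
    (F' := fun t x => eval (planeRotation i j t *ᵥ x) (angularDeriv i j p))
    (bound := fun _ => C) Filter.univ_mem
    (.of_forall fun t => (p.continuous_eval.comp (hcont t)).aestronglyMeasurable)
    (by simpa only [planeRotation_zero_mulVec] using integrable_eval hsphere p)
    ((angularDeriv i j p).continuous_eval.comp (hcont 0)).aestronglyMeasurable
    ((ae_sum_sq_eq_one hsphere).mono fun x hx t _ => hC _ <| by
      rw [sum_sq_mulVec_of_mem_orthogonalGroup (planeRotation_mem_orthogonalGroup hij t), hx])
    (integrable_const C)
    (.of_forall fun x t _ => hasDerivAt_eval_planeRotation_mulVec hij x p t)).2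
  simp only [planeRotation_zero_mulVec] at hderiv
  have hconst (t : ℝ) : ∫ x, eval (planeRotation i j t *ᵥ x) p ∂σ = ∫ x, eval x p ∂σ := by
    conv_rhs => rw [← hinv _ (planeRotation_mem_orthogonalGroup hij t)]
    rw [integral_map (hcont t).aemeasurable p.continuous_eval.aestronglyMeasurable]
  simp only [hconst] at hderiv
  exact hderiv.unique (hasDerivAt_const _ _)

/-- Integration by parts on the sphere against a coordinate function. -/
theorem integral_eval_X_mul (hsphere : σ {x | ∑ i, (x i) ^ 2 = 1} = 1)
    (hinv : ∀ A : Matrix (Fin n) (Fin n) ℝ, A ∈ Matrix.orthogonalGroup (Fin n) ℝ →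
      σ.map A.mulVec = σ) (j : Fin n) {q : MvPolynomial (Fin n) ℝ} {k : ℕ}
    (hq : q.IsHomogeneous k) :
    ((n : ℝ) + k - 1) * ∫ x, eval x (X j * q) ∂σ = ∫ x, eval x (pderiv j q) ∂σ := by
  have hpoly : ∑ i, angularDeriv i j (X i * q) =
      (∑ i, X i ^ 2) * pderiv j q - C ((n : ℝ) + k - 1) * (X j * q) := by
    have hterm (i : Fin n) : angularDeriv i j (X i * q) =
        X i ^ 2 * pderiv j q + Pi.single (M := fun _ => MvPolynomial (Fin n) ℝ) j (X j * q) i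
          - X j * q - X j * (X i * pderiv i q) := by
      rw [angularDeriv_apply, pderiv_mul, pderiv_mul, pderiv_X_self, pderiv_X]
      by_cases hij : i = j
      · subst hij
        simp
        ring
      · simp [hij]
        ring
    simp only [hterm, Finset.sum_sub_distrib, Finset.sum_add_distrib, ← Finset.mul_sum,
      ← Finset.sum_mul, hq.sum_X_mul_pderiv, Finset.sum_pi_single']
    simp
    ring
  have hzero : ∫ x, eval x (∑ i, angularDeriv i j (X i * q)) ∂σ = 0 := by
    simp only [map_sum]
    rw [integral_finsetSum _ fun i _ => integrable_eval hsphere _]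
    exact Finset.sum_eq_zero fun i _ => integral_eval_angularDeriv hsphere hinv i j _
  rw [hpoly] at hzero
  have hae : (fun x => eval x ((∑ i, X i ^ 2) * pderiv j q - C ((n : ℝ) + k - 1) * (X j * q)))
      =ᵐ[σ] fun x => eval x (pderiv j q) - ((n : ℝ) + k - 1) * eval x (X j * q) := by
    filter_upwards [ae_sum_sq_eq_one hsphere] with x hx
    rw [map_sub, map_mul, map_mul _ (C _), eval_C, map_sum]
    simp only [map_pow, eval_X, hx, one_mul]
  rw [integral_congr_ae hae, integral_sub (integrable_eval hsphere _)
    ((integrable_eval hsphere _).const_mul _), integral_const_mul] at hzero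
  linarith

theorem integral_eval_mul_eval_of_isHarmonic (hn : n ≠ 0)
    (hsphere : σ {x | ∑ i, (x i) ^ 2 = 1} = 1)
    (hinv : ∀ A : Matrix (Fin n) (Fin n) ℝ, A ∈ Matrix.orthogonalGroup (Fin n) ℝ →
      σ.map A.mulVec = σ) (d : ℕ) {f g : MvPolynomial (Fin n) ℝ}
    (hf : f.IsHomogeneous d) (hg : g.IsHomogeneous d) (hfh : IsHarmonic f) :
    ∫ x, eval x (f * g) ∂σ =
      (∏ j ∈ Finset.range d, ((n : ℝ) + 2 * j))⁻¹ * bombieri f g := by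
  induction d generalizing f g with
  | zero =>
    rw [← totalDegree_zero_iff_isHomogeneous, totalDegree_eq_zero_iff_eq_C] at hf hg
    rw [hf, hg, ← monomial_zero', bombieri_monomial_left]
    simp
  | succ d ih =>
    have hparts (j : Fin n) : ((n : ℝ) + 2 * d) * ∫ x, eval x (X j * (pderiv j f * g)) ∂σ =
        ∫ x, eval x (pderiv j (pderiv j f) * g) ∂σ +
          (∏ j ∈ Finset.range d, ((n : ℝ) + 2 * j))⁻¹ * bombieri (pderiv j f) (pderiv j g) := by
      rw [← ih (by simpa using hf.pderiv) (by simpa using hg.pderiv) (hfh.pderiv j),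
        ← integral_add (integrable_eval hsphere _) (integrable_eval hsphere _)]
      simp only [← map_add, ← pderiv_mul]
      rw [← integral_eval_X_mul hsphere hinv j (hf.pderiv.mul hg)]
      push_cast [Nat.add_sub_cancel]
      ring
    have hsum := Finset.sum_congr (rfl : (Finset.univ : Finset (Fin n)) = _) fun j _ => hparts j
    rw [← Finset.mul_sum, ← integral_finsetSum _ fun j _ => integrable_eval hsphere _,
      Finset.sum_add_distrib, ← integral_finsetSum _ fun j _ => integrable_eval hsphere _,
      ← Finset.mul_sum, sum_bombieri_pderiv f hg] at hsum
    simp only [← map_sum, ← mul_assoc, ← Finset.sum_mul] at hsum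
    rw [hf.sum_X_mul_pderiv, hfh] at hsum
    simp only [nsmul_eq_mul, zero_mul, map_zero, integral_zero, zero_add, mul_assoc,
      map_mul _ (Nat.cast _), map_natCast, integral_const_mul] at hsum
    have hd : ((d + 1 : ℕ) : ℝ) ≠ 0 := Nat.cast_ne_zero.mpr d.succ_ne_zero
    have hnd : (n : ℝ) + 2 * d ≠ 0 := by positivity
    rw [Finset.prod_range_succ, mul_inv, mul_assoc]
    apply mul_left_cancel₀ (mul_ne_zero hnd hd)
    rw [mul_assoc, hsum]
    field_simp

end Sphere

/-- for harmonic homogeneous polynomials of degree `d`, the `L²` inner product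
with respect to the rotation-invariant probability measure on the unit sphere equals
`γ_{d,n}` times the Bombieri inner product. -/
theorem stmt13 (n d : ℕ) (hn : 2 ≤ n)
    (σ : Measure (Fin n → ℝ)) [IsProbabilityMeasure σ]
    (hsphere : σ {x | ∑ i, (x i) ^ 2 = 1} = 1)
    (hinv : ∀ A : Matrix (Fin n) (Fin n) ℝ, A ∈ Matrix.orthogonalGroup (Fin n) ℝ →
      σ.map A.mulVec = σ)
    (f g : MvPolynomial (Fin n) ℝ)
    (hf : f.IsHomogeneous d) (hg : g.IsHomogeneous d)
    (hfh : IsHarmonic f) (hgh : IsHarmonic g) :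
    ∫ x, MvPolynomial.eval x f * MvPolynomial.eval x g ∂σ =
      (∏ j ∈ Finset.range d, ((n : ℝ) + 2 * j))⁻¹ * bombieri f g := by
  simpa only [map_mul] using
    integral_eval_mul_eval_of_isHarmonic (by omega) hsphere hinv d hf hg hfh
end

section
/- Let n ≥ 2, let d ∈ ℕ be even, and let X be uniformly distributed on the Euclidean ball of radius √(n+2) centered at the origin in ℝⁿ. Then for every homogeneous polynomial h of degree d on ℝⁿ, E[‖X‖₂^d·h(X)] − E[‖X‖₂^d]·E[h(X)] = η_{d/2} · ⟨‖x‖₂^d, h⟩_B, where η_{d/2} = (n+2)^d · d² / (2^{d/2}·(d/2)!·(n+2d)·(n+d)·Π_{j=0}^{d/2−1}(d+n−2j)). In particular Var(‖X‖₂^d) = (n+2)^d · d²·n / ((n+2d)(n+d)²). -/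
open MeasureTheory

/-- The isotropic Euclidean ball: radius `√(n+2)`, centered at the origin of `ℝⁿ`. -/
def isoBall (n : ℕ) : Set (Fin n → ℝ) :=
  {x | ∑ i, (x i) ^ 2 ≤ (n : ℝ) + 2}

open Real in
lemma Gamma_natCast_add_half_eq_factorial (j : ℕ) :
    Gamma (j + 1 / 2) = √π * ((2 * j).factorial / (4 ^ j * j.factorial)) := by
  induction j with
  | zero => simp [-one_div, Gamma_one_half_eq]
  | succ j ih =>
    rw [show ((j + 1 : ℕ) : ℝ) + 1 / 2 = (j + 1 / 2) + 1 by push_cast; ring,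
      Gamma_add_one (by positivity), ih, show 2 * (j + 1) = 2 * j + 1 + 1 by ring,
      Nat.factorial_succ, Nat.factorial_succ, Nat.factorial_succ]
    push_cast
    field_simp
    ring

open Real in
lemma Gamma_add_natCast_half (a : ℝ) (ha : 0 < a) (k : ℕ) :
    Gamma ((a + 2 * k) / 2) * 2 ^ k = Gamma (a / 2) * ∏ j ∈ Finset.range k, (a + 2 * j) := by
  induction k with
  | zero => simp
  | succ k ih =>
    rw [show (a + 2 * (k + 1 : ℕ)) / 2 = (a + 2 * k) / 2 + 1 by push_cast; ring,
      Gamma_add_one (by positivity), Finset.prod_range_succ, ← mul_assoc, ← ih]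
    ring

open Real in
lemma integral_Ioi_pow_mul_exp_neg_sq (m : ℕ) :
    ∫ r in Set.Ioi (0 : ℝ), r ^ m * exp (-r ^ 2) = Gamma ((m + 1) / 2) / 2 := by
  have h := integral_rpow_mul_exp_neg_rpow (p := 2) (q := m) (by norm_num)
    (by linarith [m.cast_nonneg (α := ℝ)])
  simp only [rpow_natCast, rpow_ofNat] at h
  rw [h]
  ring

open Real in
lemma integral_pow_mul_exp_neg_sq_of_odd {m : ℕ} (hm : Odd m) :
    ∫ x : ℝ, x ^ m * exp (-x ^ 2) = 0 := by
  have h := integral_neg_eq_self (fun x : ℝ ↦ x ^ m * exp (-x ^ 2)) volume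
  simp only [hm.neg_pow, even_two.neg_pow, neg_mul, integral_neg] at h
  linarith

open Real in
lemma integral_pow_mul_exp_neg_sq_of_even (j : ℕ) :
    ∫ x : ℝ, x ^ (2 * j) * exp (-x ^ 2) =
      √π * ((2 * j).factorial / (4 ^ j * j.factorial)) := by
  have h := integral_comp_abs (f := fun x : ℝ ↦ x ^ (2 * j) * exp (-x ^ 2))
  simp only [(even_two_mul j).pow_abs, sq_abs] at h
  rw [h, integral_Ioi_pow_mul_exp_neg_sq, ← Gamma_natCast_add_half_eq_factorial]
  push_cast
  rw [show (2 * (j : ℝ) + 1) / 2 = j + 1 / 2 by ring]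
  ring

/-- The integral over the unit sphere of a function on `ℝⁿ`. -/
noncomputable def sphereIntegral {n : ℕ} (f : (Fin n → ℝ) → ℝ) : ℝ :=
  ∫ u : Metric.sphere (0 : EuclideanSpace ℝ (Fin n)) 1, f (WithLp.ofLp u.1)
    ∂(volume : Measure (EuclideanSpace ℝ (Fin n))).toSphere

/-- Integration in polar coordinates of a homogeneous function times a radial one. -/
lemma integral_homogeneous_mul_radial {n m : ℕ} (hn : n ≠ 0) (f : (Fin n → ℝ) → ℝ)
    (hf : ∀ (r : ℝ) (x : Fin n → ℝ), 0 < r → f (r • x) = r ^ m * f x) (g : ℝ → ℝ) :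
    ∫ x, f x * g √(∑ i, x i ^ 2) =
      sphereIntegral f * ∫ r in Set.Ioi (0 : ℝ), r ^ (n - 1 + m) * g r := by
  have : Nonempty (Fin n) := ⟨⟨0, Nat.pos_of_ne_zero hn⟩⟩
  let E := EuclideanSpace ℝ (Fin n)
  let μ : Measure E := volume
  calc
    _ = ∫ x : E, f (WithLp.ofLp x) * g ‖x‖ := by
      have hnorm (x : E) : ‖x‖ = √(∑ i, WithLp.ofLp x i ^ 2) := by
        rw [show ‖x‖ = _ from EuclideanSpace.norm_eq x]
        simp
      simp_rw [hnorm]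
      exact ((PiLp.volume_preserving_ofLp (Fin n)).integral_comp
        (MeasurableEquiv.toLp 2 (Fin n → ℝ)).symm.measurableEmbedding _).symm
    _ = ∫ x : ({(0)}ᶜ : Set E), f (WithLp.ofLp x.1) * g ‖x.1‖ ∂(μ.comap (↑)) := by
      rw [integral_subtype_comap (measurableSet_singleton _).compl
        fun x : E ↦ f (WithLp.ofLp x) * g ‖x‖, restrict_compl_singleton]
    _ = ∫ p, f (WithLp.ofLp p.1.1) * (p.2.1 ^ m * g p.2.1)
          ∂μ.toSphere.prod (.volumeIoiPow (Module.finrank ℝ E - 1)) := by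
      rw [← μ.measurePreserving_homeomorphUnitSphereProd.integral_comp
        (Homeomorph.measurableEmbedding _)]
      refine integral_congr_ae (.of_forall fun x ↦ ?_)
      have hx : 0 < ‖x.1‖ := norm_pos_iff.2 x.2
      have h := hf ‖x.1‖ (WithLp.ofLp (‖x.1‖⁻¹ • x.1)) hx
      rw [← WithLp.ofLp_smul, smul_inv_smul₀ hx.ne'] at h
      simp [h]
      ring
    _ = sphereIntegral f * ∫ r : Set.Ioi (0 : ℝ), r.1 ^ m * g r.1
          ∂.volumeIoiPow (Module.finrank ℝ E - 1) :=
      integral_prod_mul (fun u : Metric.sphere (0 : E) 1 ↦ f (WithLp.ofLp u.1))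
        (fun r : Set.Ioi (0 : ℝ) ↦ r.1 ^ m * g r.1)
    _ = _ := by
      congr 1
      simp only [Measure.volumeIoiPow, ENNReal.ofReal]
      rw [integral_withDensity_eq_integral_smul
          (measurable_subtype_coe.pow_const _).real_toNNReal,
        integral_subtype_comap measurableSet_Ioi
          fun a ↦ Real.toNNReal (a ^ (Module.finrank ℝ E - 1)) • (a ^ m * g a)]
      refine setIntegral_congr_fun measurableSet_Ioi fun x hx ↦ ?_
      simp only [NNReal.smul_def, Real.coe_toNNReal _ (pow_nonneg (le_of_lt hx) _)]
      simp [E, pow_add, mul_assoc]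

lemma sphereIntegral_mul_Gamma {n m : ℕ} (hn : n ≠ 0) (f : (Fin n → ℝ) → ℝ)
    (hf : ∀ (r : ℝ) (x : Fin n → ℝ), 0 < r → f (r • x) = r ^ m * f x) :
    sphereIntegral f * (Real.Gamma ((n + m) / 2) / 2) =
      ∫ x, f x * Real.exp (-∑ i, x i ^ 2) := by
  have h := integral_homogeneous_mul_radial hn f hf fun r ↦ Real.exp (-r ^ 2)
  simp only [Real.sq_sqrt (Finset.sum_nonneg fun i _ ↦ sq_nonneg _)] at h
  rw [h, integral_Ioi_pow_mul_exp_neg_sq]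
  congr 4
  rw [Nat.cast_add, Nat.cast_pred (Nat.pos_of_ne_zero hn)]
  ring

lemma setIntegral_isoBall {n m : ℕ} (hn : n ≠ 0) (f : (Fin n → ℝ) → ℝ)
    (hf : ∀ (r : ℝ) (x : Fin n → ℝ), 0 < r → f (r • x) = r ^ m * f x) (j : ℕ) :
    ∫ x in isoBall n, (∑ i, x i ^ 2) ^ j * f x =
      sphereIntegral f * (√(n + 2) ^ (n + m + 2 * j) / (n + m + 2 * j)) := by
  have hmeas : MeasurableSet (isoBall n) := measurableSet_le (by fun_prop) (by fun_prop)
  have h := integral_homogeneous_mul_radial hn f hf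
    ((Set.Iic √(n + 2)).indicator fun r ↦ r ^ (2 * j))
  rw [← integral_indicator hmeas]
  convert! h using 1
  · refine integral_congr_ae (.of_forall fun x ↦ ?_)
    have hx : 0 ≤ ∑ i, x i ^ 2 := Finset.sum_nonneg fun i _ ↦ sq_nonneg _
    by_cases hxs : ∑ i, x i ^ 2 ≤ (n : ℝ) + 2
    · have hpow : √(∑ i, x i ^ 2) ^ (2 * j) = (∑ i, x i ^ 2) ^ j := by
        rw [pow_mul, Real.sq_sqrt hx]
      simp [isoBall, Set.indicator, hxs, Real.sqrt_le_sqrt hxs, hpow, mul_comm (f x)]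
    · have : ¬ √(∑ i, x i ^ 2) ≤ √((n : ℝ) + 2) := by
        rwa [Real.sqrt_le_sqrt_iff (by positivity)]
      simp [isoBall, Set.indicator, hxs, this]
  · congr 1
    have : ∀ r : ℝ, r ^ (n - 1 + m) * (Set.Iic √((n : ℝ) + 2)).indicator (fun r ↦ r ^ (2 * j)) r =
        (Set.Iic √((n : ℝ) + 2)).indicator (fun r ↦ r ^ (n - 1 + m + 2 * j)) r := fun r ↦ by
      by_cases hr : r ≤ √((n : ℝ) + 2) <;> simp [hr, pow_add]
    simp_rw [this]
    rw [setIntegral_indicator measurableSet_Iic, Set.Ioi_inter_Iic,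
      ← intervalIntegral.integral_of_le (Real.sqrt_nonneg _), integral_pow,
      show n - 1 + m + 2 * j + 1 = n + m + 2 * j by omega]
    have : ((n - 1 + m + 2 * j : ℕ) : ℝ) + 1 = n + m + 2 * j := by
      push_cast [Nat.cast_pred (Nat.pos_of_ne_zero hn)]; ring
    rw [this, zero_pow (by omega), sub_zero]

lemma sphereIntegral_one_pos {n : ℕ} (hn : n ≠ 0) :
    0 < sphereIntegral (fun _ : Fin n → ℝ ↦ 1) := by
  have : Nonempty (Fin n) := ⟨⟨0, Nat.pos_of_ne_zero hn⟩⟩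
  have : NeZero (volume : Measure (EuclideanSpace ℝ (Fin n))).toSphere :=
    ⟨Measure.toSphere_ne_zero _⟩
  simp [sphereIntegral, -Measure.toSphere_real_apply_univ, measureReal_univ_pos]

/-- Moments of the uniform measure on the isotropic ball. -/
lemma integral_unif_isoBall {n m : ℕ} (hn : n ≠ 0) (f : (Fin n → ℝ) → ℝ)
    (hf : ∀ (r : ℝ) (x : Fin n → ℝ), 0 < r → f (r • x) = r ^ m * f x) (j : ℕ) :
    ∫ x, (∑ i, x i ^ 2) ^ j * f x ∂(unif (isoBall n)) =
      n * √(n + 2) ^ (m + 2 * j) / (n + m + 2 * j) *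
        (sphereIntegral f / sphereIntegral (fun _ : Fin n → ℝ ↦ 1)) := by
  have hvol : (volume (isoBall n)).toReal =
      sphereIntegral (fun _ : Fin n → ℝ ↦ 1) * (√(n + 2) ^ n / n) := by
    simpa [measureReal_def] using setIntegral_isoBall (m := 0) hn (fun _ ↦ 1) (by simp) 0
  have h1 := sphereIntegral_one_pos hn
  have hR : 0 < √((n : ℝ) + 2) := by positivity
  rw [unif, integral_smul_measure, setIntegral_isoBall hn f hf, ENNReal.toReal_inv, hvol]
  have : (n : ℝ) ≠ 0 := by exact_mod_cast hn
  have : (0 : ℝ) < n + m + 2 * j := by positivity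
  simp only [smul_eq_mul]
  field_simp
  ring

lemma coeff_sum_X_sq_pow_two_nsmul {n : ℕ} (J : Fin n →₀ ℕ) :
    MvPolynomial.coeff (2 • J) ((∑ j : Fin n, MvPolynomial.X j ^ 2 : MvPolynomial (Fin n) ℝ) ^
      (∑ i, J i)) = (∑ i, J i).factorial / ∏ i, ((J i).factorial : ℝ) := by
  have h : (∑ j : Fin n, MvPolynomial.X j ^ 2 : MvPolynomial (Fin n) ℝ) =
      MvPolynomial.expand 2 (∑ j, MvPolynomial.X j) := by simp
  rw [h, ← map_pow, MvPolynomial.coeff_expand_smul _ two_ne_zero,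
    MvPolynomial.coeff_sum_X_pow_of_fintype, if_pos (Finsupp.sum_fintype _ _ fun _ ↦ rfl),
    Finsupp.multinomial_eq_of_support_subset (Finset.subset_univ _),
    eq_div_iff (Finset.prod_ne_zero_iff.2 fun i _ ↦ by positivity), mul_comm]
  exact_mod_cast Nat.multinomial_spec (Finset.univ : Finset (Fin n)) J

lemma coeff_sum_X_sq_pow_of_odd {n : ℕ} (k : ℕ) (m : Fin n →₀ ℕ) {i : Fin n} (hi : Odd (m i)) :
    MvPolynomial.coeff m
      ((∑ j : Fin n, MvPolynomial.X j ^ 2 : MvPolynomial (Fin n) ℝ) ^ k) = 0 := by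
  have h : (∑ j : Fin n, MvPolynomial.X j ^ 2 : MvPolynomial (Fin n) ℝ) =
      MvPolynomial.expand 2 (∑ j, MvPolynomial.X j) := by simp
  rw [h, ← map_pow]
  exact MvPolynomial.coeff_expand_of_not_dvd _ (i := i) fun h ↦
    Nat.not_even_iff_odd.2 hi (even_iff_two_dvd.2 h)

lemma integral_prod_pow_mul_exp_neg {n : ℕ} (m : Fin n → ℕ) :
    ∫ x : Fin n → ℝ, (∏ i, x i ^ m i) * Real.exp (-∑ i, x i ^ 2) =
      ∏ i, ∫ t : ℝ, t ^ m i * Real.exp (-t ^ 2) := by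
  rw [← integral_fintype_prod_volume_eq_prod fun i (t : ℝ) ↦ t ^ m i * Real.exp (-t ^ 2)]
  simp [← Finset.sum_neg_distrib, Real.exp_sum, Finset.prod_mul_distrib]

lemma prod_pow_smul {n : ℕ} (m : Fin n → ℕ) (r : ℝ) (x : Fin n → ℝ) :
    ∏ i, (r • x) i ^ m i = r ^ (∑ i, m i) * ∏ i, x i ^ m i := by
  simp [mul_pow, Finset.prod_mul_distrib, Finset.prod_pow_eq_pow_sum]

lemma sphereIntegral_one_mul_Gamma {n : ℕ} (hn : n ≠ 0) :
    sphereIntegral (fun _ : Fin n → ℝ ↦ 1) * (Real.Gamma (n / 2) / 2) = √Real.pi ^ n := by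
  have h := sphereIntegral_mul_Gamma (m := 0) hn (fun _ ↦ 1) (by simp)
  have h2 := integral_prod_pow_mul_exp_neg (n := n) 0
  have h3 := integral_pow_mul_exp_neg_sq_of_even 0
  simp only [Pi.zero_apply, pow_zero, Finset.prod_const_one] at h2
  simp only [mul_zero, pow_zero] at h3
  rw [h2, h3] at h
  simpa using h

/-- The spherical moments in terms of the coefficients of a power of `∑ j, X j ^ 2`. -/
lemma sphereIntegral_prod_pow {n k : ℕ} (hn : n ≠ 0) (m : Fin n →₀ ℕ) (hm : ∑ i, m i = 2 * k) :
    sphereIntegral (fun x ↦ ∏ i, x i ^ m i) * (2 ^ k * k.factorial *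
        ∏ j ∈ Finset.range k, ((n : ℝ) + 2 * j)) =
      sphereIntegral (fun _ : Fin n → ℝ ↦ 1) * ((∏ i, ((m i).factorial : ℝ)) *
        ((∑ j : Fin n, MvPolynomial.X j ^ 2 : MvPolynomial (Fin n) ℝ) ^ k).coeff m) := by
  have h := sphereIntegral_mul_Gamma hn (fun x ↦ ∏ i, x i ^ m i) (m := 2 * k)
    fun r x _ ↦ by rw [← hm]; exact prod_pow_smul m r x
  rw [integral_prod_pow_mul_exp_neg] at h
  have hΓ := Gamma_add_natCast_half n (by positivity) k
  have hΓpos : 0 < Real.Gamma (((n : ℝ) + 2 * k) / 2) := Real.Gamma_pos_of_pos (by positivity)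
  have hΓ1 : 0 < Real.Gamma ((n : ℝ) / 2) := Real.Gamma_pos_of_pos (by positivity)
  push_cast at h
  by_cases hodd : ∃ i, Odd (m i)
  · obtain ⟨i, hi⟩ := hodd
    rw [Finset.prod_eq_zero (Finset.mem_univ i) (integral_pow_mul_exp_neg_sq_of_odd hi)] at h
    have h0 := (mul_eq_zero.1 h).resolve_right (by positivity)
    rw [coeff_sum_X_sq_pow_of_odd k m hi, h0]
    simp
  · push Not at hodd
    simp only [Nat.not_odd_iff_even, even_iff_two_dvd] at hodd
    obtain ⟨J, rfl⟩ : ∃ J : Fin n →₀ ℕ, m = 2 • J := by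
      choose J hJ using hodd
      exact ⟨Finsupp.equivFunOnFinite.symm J, by ext i; simp [hJ]⟩
    obtain rfl : ∑ i, J i = k := by
      simp only [Finsupp.smul_apply, smul_eq_mul, ← Finset.mul_sum] at hm
      omega
    rw [coeff_sum_X_sq_pow_two_nsmul]
    have h1 := sphereIntegral_one_mul_Gamma hn
    simp only [Finsupp.smul_apply, smul_eq_mul, integral_pow_mul_exp_neg_sq_of_even,
      Finset.prod_mul_distrib, Finset.prod_div_distrib, Finset.prod_pow_eq_pow_sum,
      Finset.prod_const, Finset.card_univ, Fintype.card_fin, ← h1] at h ⊢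
    generalize (∑ i, J i) = k at *
    have hJ : 0 < ∏ i, ((J i).factorial : ℝ) := Finset.prod_pos fun i _ ↦ by positivity
    rw [show (4 : ℝ) ^ k = 2 ^ k * 2 ^ k by rw [← mul_pow]; norm_num] at h
    field_simp at h ⊢
    refine mul_right_cancel₀ hΓ1.ne' ?_
    linear_combination h - sphereIntegral (fun x : Fin n → ℝ ↦ ∏ i, x i ^ (2 * J i)) * 2 ^ k *
      (∏ i, ((J i).factorial : ℝ)) * hΓ

lemma sphereIntegral_eval {n k : ℕ} (hn : n ≠ 0) (h : MvPolynomial (Fin n) ℝ)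
    (hh : h.IsHomogeneous (2 * k)) :
    sphereIntegral (fun x ↦ MvPolynomial.eval x h) * (2 ^ k * k.factorial *
        ∏ j ∈ Finset.range k, ((n : ℝ) + 2 * j)) =
      sphereIntegral (fun _ : Fin n → ℝ ↦ 1) *
        bombieri ((∑ j : Fin n, MvPolynomial.X j ^ 2) ^ k) h := by
  have hb : bombieri ((∑ j : Fin n, MvPolynomial.X j ^ 2) ^ k) h =
      ∑ m ∈ h.support, h.coeff m * ((∏ i, ((m i).factorial : ℝ)) *
        ((∑ j : Fin n, MvPolynomial.X j ^ 2 : MvPolynomial (Fin n) ℝ) ^ k).coeff m) := by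
    unfold bombieri
    trans ∑ m ∈ h.support ∪ ((∑ j : Fin n, MvPolynomial.X j ^ 2 : MvPolynomial _ ℝ) ^ k).support,
      h.coeff m * ((∏ i, ((m i).factorial : ℝ)) *
        ((∑ j : Fin n, MvPolynomial.X j ^ 2 : MvPolynomial (Fin n) ℝ) ^ k).coeff m)
    · rw [← Finset.sum_subset Finset.subset_union_right]
      · exact Finset.sum_congr rfl fun m _ ↦ by ring
      · intro m _ hm
        rw [MvPolynomial.notMem_support_iff.1 hm]
        simp
    · refine (Finset.sum_subset Finset.subset_union_left fun m _ hm ↦ ?_).symm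
      rw [MvPolynomial.notMem_support_iff.1 hm, zero_mul]
  have hs : sphereIntegral (fun x ↦ MvPolynomial.eval x h) =
      ∑ m ∈ h.support, h.coeff m * sphereIntegral (fun x ↦ ∏ i, x i ^ m i) := by
    simp only [sphereIntegral, MvPolynomial.eval_eq']
    rw [integral_finsetSum]
    · simp only [integral_const_mul]
    · intro m _
      exact (Continuous.integrable_of_hasCompactSupport (by fun_prop)
        (HasCompactSupport.of_compactSpace _))
  rw [hb, hs, Finset.sum_mul, Finset.mul_sum]
  refine Finset.sum_congr rfl fun m hm ↦ ?_
  have hdeg : ∑ i, m i = 2 * k := by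
    rw [← Finsupp.degree_eq_sum]
    rw [Finsupp.degree_eq_weight_one]
    exact hh (MvPolynomial.mem_support_iff.1 hm)
  rw [mul_assoc, sphereIntegral_prod_pow hn m hdeg]
  ring

lemma prod_range_add_two_mul_reflect (a : ℝ) (k : ℕ) :
    (∏ j ∈ Finset.range k, (2 * k + a - 2 * j)) * a =
      (∏ j ∈ Finset.range k, (a + 2 * j)) * (a + 2 * k) := by
  have h : ∏ j ∈ Finset.range k, (2 * k + a - 2 * j) =
      ∏ j ∈ Finset.range k, (a + 2 * (j + 1 : ℕ)) := by
    rw [← Finset.prod_range_reflect]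
    refine Finset.prod_congr rfl fun j hj ↦ ?_
    rw [Finset.mem_range] at hj
    rw [show k - 1 - j = k - (j + 1) by omega, Nat.cast_sub (by omega)]
    push_cast
    ring
  rw [h, ← Finset.prod_range_succ, Finset.prod_range_succ']
  simp

lemma MvPolynomial.IsHomogeneous.eval_smul_eq {n d : ℕ} {h : MvPolynomial (Fin n) ℝ}
    (hh : h.IsHomogeneous d) (r : ℝ) (x : Fin n → ℝ) :
    MvPolynomial.eval (r • x) h = r ^ d * MvPolynomial.eval x h := by
  simp only [MvPolynomial.eval_eq', Finset.mul_sum]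
  refine Finset.sum_congr rfl fun m hm ↦ ?_
  have hdeg : ∑ i, m i = d := by
    rw [← Finsupp.degree_eq_sum, Finsupp.degree_eq_weight_one]
    exact hh (MvPolynomial.mem_support_iff.1 hm)
  rw [prod_pow_smul, hdeg]
  ring


/-- the eigenvalue `η_{d/2}` corresponding to the eigenvector `‖x‖₂^d`
(for `d` even), and the variance of `‖X‖₂^d` on the isotropic Euclidean ball. -/
theorem stmt16 (n d : ℕ) (hn : 2 ≤ n) (hd : Even d) :
    (∀ h : MvPolynomial (Fin n) ℝ, h.IsHomogeneous d →
      (∫ x, (∑ i, (x i) ^ 2) ^ (d / 2) * MvPolynomial.eval x h ∂(unif (isoBall n))) -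
          (∫ x, (∑ i, (x i) ^ 2) ^ (d / 2) ∂(unif (isoBall n))) *
          (∫ x, MvPolynomial.eval x h ∂(unif (isoBall n))) =
        (((n : ℝ) + 2) ^ d * (d : ℝ) ^ 2 /
            ((2 : ℝ) ^ (d / 2) * ((d / 2).factorial : ℝ) * ((n : ℝ) + 2 * d) *
              ((n : ℝ) + d) * ∏ j ∈ Finset.range (d / 2), ((d : ℝ) + n - 2 * j))) *
          bombieri ((∑ j : Fin n, MvPolynomial.X j ^ 2) ^ (d / 2)) h) ∧
    (∫ x, ((∑ i, (x i) ^ 2) ^ (d / 2)) ^ 2 ∂(unif (isoBall n))) -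
        (∫ x, (∑ i, (x i) ^ 2) ^ (d / 2) ∂(unif (isoBall n))) ^ 2 =
      ((n : ℝ) + 2) ^ d * (d : ℝ) ^ 2 * n / (((n : ℝ) + 2 * d) * ((n : ℝ) + d) ^ 2) := by
  have hn0 : n ≠ 0 := by omega
  have hnpos : (0 : ℝ) < n := by positivity
  obtain ⟨k, rfl⟩ : ∃ k, d = 2 * k := even_iff_two_dvd.1 hd
  rw [Nat.mul_div_cancel_left k two_pos]
  have hsqrt (j : ℕ) : √((n : ℝ) + 2) ^ (2 * j) = ((n : ℝ) + 2) ^ j := by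
    rw [pow_mul, Real.sq_sqrt (by positivity)]
  have hS := sphereIntegral_one_pos hn0
  have hradial (j : ℕ) : ∫ x, (∑ i, (x i) ^ 2) ^ j ∂(unif (isoBall n)) =
      n * ((n : ℝ) + 2) ^ j / (n + 2 * j) := by
    simpa [hsqrt, hS.ne'] using integral_unif_isoBall (m := 0) hn0 (fun _ ↦ 1) (by simp) j
  refine ⟨fun h hh ↦ ?_, ?_⟩
  · have hhom (r : ℝ) (x : Fin n → ℝ) (_ : 0 < r) :
        MvPolynomial.eval (r • x) h = r ^ (2 * k) * MvPolynomial.eval x h :=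
      hh.eval_smul_eq r x
    have h1 := integral_unif_isoBall hn0 (fun x ↦ MvPolynomial.eval x h) hhom k
    have h0 := integral_unif_isoBall hn0 (fun x ↦ MvPolynomial.eval x h) hhom 0
    simp only [pow_zero, one_mul, mul_zero, Nat.cast_zero, add_zero] at h0
    rw [h1, h0, hradial, ← mul_add, hsqrt, hsqrt]
    have hs := sphereIntegral_eval hn0 h hh
    have hP : 0 < ∏ j ∈ Finset.range k, ((n : ℝ) + 2 * j) :=
      Finset.prod_pos fun j _ ↦ by positivity
    have hQ := eq_div_of_mul_eq hnpos.ne' (prod_range_add_two_mul_reflect n k)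
    push_cast
    rw [hQ, eq_div_of_mul_eq (by positivity) hs]
    field_simp
    ring
  · simp_rw [← pow_mul, mul_comm k 2, hradial]
    push_cast
    field_simp
    ring
end

section
/- Let n ≥ 3 and let X be uniformly distributed on the Euclidean ball of radius √(n+2) centered at the origin in ℝⁿ. Then: (i) Var(Σᵢ₌₁ⁿ Xᵢ²) = 4n/(n+4); (ii) for every homogeneous polynomial f(x) = Σ_{|I|=2} α_I x^I of degree 2 whose coefficient vector is orthogonal to that of Σᵢ xᵢ² (i.e. Σᵢ₌₁ⁿ α_{2e_i} = 0, where 2e_i is the multi-index with 2 in coordinate i and 0 elsewhere), one has Var(f(X)) ≥ (5/7)·Σ_{|I|=2} α_I². -/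
open MeasureTheory

lemma isoBall_eq_preimage (n : ℕ) :
    isoBall n =
      WithLp.toLp 2 ⁻¹' Metric.closedBall (0 : EuclideanSpace ℝ (Fin n)) √((n : ℝ) + 2) := by
  ext x
  simp only [isoBall, Set.mem_ofPred_eq, Set.mem_preimage, mem_closedBall_zero_iff,
    EuclideanSpace.norm_eq, Real.norm_eq_abs, sq_abs]
  rw [Real.sqrt_le_sqrt_iff (by positivity)]

lemma isCompact_isoBall (n : ℕ) : IsCompact (isoBall n) := by
  rw [isoBall_eq_preimage]
  exact (EuclideanSpace.equiv (Fin n) ℝ).symm.toHomeomorph.isCompact_preimage.2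
    (isCompact_closedBall _ _)

lemma setIntegral_isoBall_eq (n : ℕ) (f : EuclideanSpace ℝ (Fin n) → ℝ) :
    ∫ x in isoBall n, f (WithLp.toLp 2 x) =
      ∫ x in Metric.closedBall (0 : EuclideanSpace ℝ (Fin n)) √((n : ℝ) + 2), f x := by
  rw [isoBall_eq_preimage]
  exact (PiLp.volume_preserving_toLp (Fin n)).setIntegral_preimage_emb
    (MeasurableEquiv.toLp 2 (Fin n → ℝ)).measurableEmbedding f _

lemma integral_unif {n : ℕ} (s : Set (Fin n → ℝ)) (f : (Fin n → ℝ) → ℝ) :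
    ∫ x, f x ∂(unif s) = (volume.real s)⁻¹ * ∫ x in s, f x := by
  simp [unif, integral_smul_measure, measureReal_def]

lemma setIntegral_isoBall_sum_sq_pow {n : ℕ} (hn : n ≠ 0) (k : ℕ) :
    ∫ x in isoBall n, (∑ i, x i ^ 2) ^ k =
      n * volume.real (Metric.ball (0 : EuclideanSpace ℝ (Fin n)) 1) *
        (√((n : ℝ) + 2) ^ (n + 2 * k) / (n + 2 * k)) := by
  have : NeZero n := ⟨hn⟩
  have : Nonempty (Fin n) := ⟨0⟩
  set R := √((n : ℝ) + 2)
  have hR : 0 ≤ R := Real.sqrt_nonneg _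
  calc ∫ x in isoBall n, (∑ i, x i ^ 2) ^ k
      = ∫ x in Metric.closedBall (0 : EuclideanSpace ℝ (Fin n)) R, ‖x‖ ^ (2 * k) := by
        rw [← setIntegral_isoBall_eq]
        simp [pow_mul, EuclideanSpace.norm_sq_eq]
    _ = ∫ x : EuclideanSpace ℝ (Fin n),
          (Set.Iic R).indicator (fun y : ℝ ↦ y ^ (2 * k)) ‖x‖ := by
        rw [← integral_indicator Metric.isClosed_closedBall.measurableSet]
        congr with x
        simp [Set.indicator]
    _ = _ := by
        rw [integral_fun_norm_addHaar, finrank_euclideanSpace_fin, nsmul_eq_mul, smul_eq_mul,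
          mul_assoc]
        congr 2
        have h (y : ℝ) : y ^ (n - 1) • (Set.Iic R).indicator (fun y : ℝ ↦ y ^ (2 * k)) y =
            (Set.Iic R).indicator (fun y : ℝ ↦ y ^ (n - 1 + 2 * k)) y := by
          by_cases hy : y ∈ Set.Iic R <;> simp [hy, pow_add]
        simp_rw [h]
        rw [setIntegral_indicator measurableSet_Iic, Set.Ioi_inter_Iic,
          ← intervalIntegral.integral_of_le hR, integral_pow]
        have h1 : n - 1 + 2 * k + 1 = n + 2 * k := by omega
        have h2 : ((n - 1 + 2 * k : ℕ) : ℝ) + 1 = n + 2 * k := by exact_mod_cast h1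
        rw [h1, h2, zero_pow (by omega), sub_zero]

lemma volume_real_isoBall {n : ℕ} (hn : n ≠ 0) :
    volume.real (isoBall n) =
      volume.real (Metric.ball (0 : EuclideanSpace ℝ (Fin n)) 1) * √((n : ℝ) + 2) ^ n := by
  have h := setIntegral_isoBall_sum_sq_pow hn 0
  have : (n : ℝ) ≠ 0 := by exact_mod_cast hn
  simp only [pow_zero, integral_const, MeasurableSet.univ, measureReal_restrict_apply,
    Set.univ_inter, smul_eq_mul, mul_one] at h
  rw [h]
  simp
  field_simp

lemma volume_real_isoBall_pos {n : ℕ} (hn : n ≠ 0) : 0 < volume.real (isoBall n) := by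
  rw [volume_real_isoBall hn]
  have := Metric.isOpen_ball.measure_pos (μ := (volume : Measure (EuclideanSpace ℝ (Fin n))))
    ⟨0, Metric.mem_ball_self one_pos⟩
  exact mul_pos (ENNReal.toReal_pos this.ne' measure_ball_lt_top.ne) (by positivity)

lemma integral_unif_isoBall_sum_sq_pow {n : ℕ} (hn : n ≠ 0) (k : ℕ) :
    ∫ x, (∑ i, x i ^ 2) ^ k ∂(unif (isoBall n)) = n * (n + 2) ^ k / (n + 2 * k) := by
  have h := volume_real_isoBall_pos hn
  rw [volume_real_isoBall hn] at h
  have hB := pos_of_mul_pos_left h (by positivity)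
  rw [integral_unif, setIntegral_isoBall_sum_sq_pow hn, volume_real_isoBall hn, pow_add, pow_mul,
    Real.sq_sqrt (by positivity)]
  field_simp

lemma integrable_unif_isoBall {n : ℕ} (hn : n ≠ 0) {f : (Fin n → ℝ) → ℝ} (hf : Continuous f) :
    Integrable f (unif (isoBall n)) := by
  refine Integrable.smul_measure (hf.continuousOn.integrableOn_compact (isCompact_isoBall n)) ?_
  have := volume_real_isoBall_pos hn
  simp only [ne_eq, ENNReal.inv_eq_top]
  intro h
  simp [measureReal_def, h] at this

lemma integral_unif_isoBall_reflection {n : ℕ} (v : Fin n → ℝ) (f : (Fin n → ℝ) → ℝ) :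
    ∫ x, f (x - (2 * (v ⬝ᵥ x / (v ⬝ᵥ v))) • v) ∂(unif (isoBall n)) =
      ∫ x, f x ∂(unif (isoBall n)) := by
  rw [integral_unif, integral_unif]
  congr 1
  set T := (ℝ ∙ (WithLp.toLp 2 v : EuclideanSpace ℝ (Fin n)))ᗮ.reflection with hT
  have h (x : Fin n → ℝ) : x - (2 * (v ⬝ᵥ x / (v ⬝ᵥ v))) • v = (T (WithLp.toLp 2 x)).ofLp := by
    have hv : ‖(WithLp.toLp 2 v : EuclideanSpace ℝ (Fin n))‖ ^ 2 = v ⬝ᵥ v := by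
      rw [EuclideanSpace.norm_sq_eq]
      simp [dotProduct, sq]
    rw [hT, Submodule.reflection_orthogonal_apply, Submodule.reflection_singleton_apply,
      EuclideanSpace.inner_toLp_toLp, star_trivial, dotProduct_comm]
    ext i
    simp [hv, mul_assoc]
  simp_rw [h]
  rw [setIntegral_isoBall_eq n (fun y ↦ f (T y).ofLp)]
  have hpre : T ⁻¹' Metric.closedBall 0 √((n : ℝ) + 2) = Metric.closedBall 0 √((n : ℝ) + 2) := by
    ext y
    simp
  have := T.measurePreserving.setIntegral_preimage_emb T.toHomeomorph.measurableEmbedding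
    (fun y ↦ f y.ofLp) (Metric.closedBall 0 √((n : ℝ) + 2))
  rw [hpre] at this
  rw [this, ← setIntegral_isoBall_eq n (fun y ↦ f y.ofLp)]

lemma integral_unif_isoBall_eq_zero_of_odd {n : ℕ} (i : Fin n) {f : (Fin n → ℝ) → ℝ}
    (hf : ∀ x, f (Function.update x i (-x i)) = -f x) : ∫ x, f x ∂(unif (isoBall n)) = 0 := by
  have h := integral_unif_isoBall_reflection (Pi.single i 1) f
  have hx (x : Fin n → ℝ) : x - (2 * (Pi.single i 1 ⬝ᵥ x / (Pi.single i 1 ⬝ᵥ Pi.single i 1))) •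
      Pi.single i 1 = Function.update x i (-x i) := by
    ext k
    rcases eq_or_ne k i with rfl | hk
    · simp
      ring
    · simp [hk]
  simp_rw [hx, hf, integral_neg] at h
  linarith

lemma integral_unif_isoBall_comp_swap {n : ℕ} (i j : Fin n) (f : (Fin n → ℝ) → ℝ) :
    ∫ x, f (x ∘ Equiv.swap i j) ∂(unif (isoBall n)) = ∫ x, f x ∂(unif (isoBall n)) := by
  rcases eq_or_ne i j with rfl | hij
  · simp
  rw [← integral_unif_isoBall_reflection (Pi.single i 1 - Pi.single j 1) f]
  congr with x
  congr 1
  ext k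
  rcases eq_or_ne k i with rfl | hki
  · simp [sub_dotProduct, hij, hij.symm]
    ring
  rcases eq_or_ne k j with rfl | hkj
  · simp [sub_dotProduct, hij, hij.symm]
    ring
  · simp [sub_dotProduct, hij, hij.symm, Equiv.swap_apply_of_ne_of_ne, hki, hkj]

lemma integral_unif_isoBall_mul_eq_zero {n : ℕ} {i j : Fin n} (hij : i ≠ j) :
    ∫ x, x i * x j ∂(unif (isoBall n)) = 0 :=
  integral_unif_isoBall_eq_zero_of_odd i fun x ↦ by simp [hij.symm]

lemma integral_unif_isoBall_mul_mul_mul_eq_zero {n : ℕ} {i j k l : Fin n}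
    (hij : i ≠ j) (hik : i ≠ k) (hil : i ≠ l) :
    ∫ x, x i * x j * x k * x l ∂(unif (isoBall n)) = 0 :=
  integral_unif_isoBall_eq_zero_of_odd i fun x ↦ by simp [hij.symm, hik.symm, hil.symm]

lemma integral_unif_isoBall_sq_eq {n : ℕ} (i j : Fin n) :
    ∫ x, x i ^ 2 ∂(unif (isoBall n)) = ∫ x, x j ^ 2 ∂(unif (isoBall n)) := by
  simpa using integral_unif_isoBall_comp_swap i j (fun x ↦ x j ^ 2)

lemma integral_unif_isoBall_pow_four_eq {n : ℕ} (i j : Fin n) :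
    ∫ x, x i ^ 4 ∂(unif (isoBall n)) = ∫ x, x j ^ 4 ∂(unif (isoBall n)) := by
  simpa using integral_unif_isoBall_comp_swap i j (fun x ↦ x j ^ 4)

lemma integral_unif_isoBall_pow_four_eq_three_mul {n : ℕ} {i j : Fin n} (hij : i ≠ j) :
    ∫ x, x i ^ 4 ∂(unif (isoBall n)) = 3 * ∫ x, x i ^ 2 * x j ^ 2 ∂(unif (isoBall n)) := by
  have hn : n ≠ 0 := by
    rintro rfl
    exact i.elim0
  have h := integral_unif_isoBall_reflection (Pi.single i 1 - Pi.single j 2) (fun x ↦ x i ^ 4)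
  have hx (x : Fin n → ℝ) : (x - (2 * ((Pi.single i (1 : ℝ) - Pi.single j 2) ⬝ᵥ x /
      ((Pi.single i 1 - Pi.single j 2) ⬝ᵥ (Pi.single i 1 - Pi.single j 2)))) •
        (Pi.single i 1 - Pi.single j 2) : Fin n → ℝ) i ^ 4 =
      81 / 625 * x i ^ 4 + 256 / 625 * x j ^ 4 + 864 / 625 * (x i ^ 2 * x j ^ 2) +
        (432 / 625 * (x i ^ 3 * x j) + 768 / 625 * (x i * x j ^ 3)) := by
    simp [sub_dotProduct, hij, hij.symm]
    ring
  have hI {f : (Fin n → ℝ) → ℝ} (hf : Continuous f) := integrable_unif_isoBall hn hf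
  simp_rw [hx] at h
  rw [integral_add (hI (by fun_prop)) (hI (by fun_prop)),
    integral_add (hI (by fun_prop)) (hI (by fun_prop)),
    integral_add (hI (by fun_prop)) (hI (by fun_prop)),
    integral_add (hI (by fun_prop)) (hI (by fun_prop))] at h
  simp_rw [integral_const_mul] at h
  rw [integral_unif_isoBall_eq_zero_of_odd (f := fun x ↦ x i ^ 3 * x j) j
      fun x ↦ by simp [hij],
    integral_unif_isoBall_eq_zero_of_odd (f := fun x ↦ x i * x j ^ 3) i
      fun x ↦ by simp [hij.symm],
    integral_unif_isoBall_pow_four_eq j i] at h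
  linarith

lemma integral_unif_isoBall_sq_mul_sq {n : ℕ} (hn : 2 ≤ n) (i j : Fin n) :
    ∫ x, x i ^ 2 * x j ^ 2 ∂(unif (isoBall n)) =
      ((n : ℝ) + 2) / (n + 4) * (if i = j then 3 else 1) := by
  have hn0 : n ≠ 0 := by omega
  have : Nontrivial (Fin n) := Fin.nontrivial_iff_two_le.2 hn
  obtain ⟨p, hp⟩ : ∃ p : ℝ, ∀ i j : Fin n,
      ∫ x, x i ^ 2 * x j ^ 2 ∂(unif (isoBall n)) = p * (if i = j then 3 else 1) := by
    refine ⟨(∫ x, x i ^ 4 ∂(unif (isoBall n))) / 3, fun k l ↦ ?_⟩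
    rw [integral_unif_isoBall_pow_four_eq i k]
    split_ifs with hkl
    · subst hkl
      simp_rw [← pow_add]
      ring
    · rw [integral_unif_isoBall_pow_four_eq_three_mul hkl]
      ring
  have h := integral_unif_isoBall_sum_sq_pow hn0 2
  have hI {f : (Fin n → ℝ) → ℝ} (hf : Continuous f) := integrable_unif_isoBall hn0 hf
  simp_rw [sq (∑ i, _), Finset.sum_mul_sum] at h
  rw [integral_finsetSum _ fun i _ ↦ hI (by fun_prop)] at h
  have h' (i : Fin n) := integral_finsetSum (μ := unif (isoBall n)) Finset.univ fun j _ ↦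
    hI (f := fun x ↦ x i ^ 2 * x j ^ 2) (by fun_prop)
  simp_rw [h', hp, ← Finset.mul_sum] at h
  have hs : ∑ i : Fin n, ∑ j : Fin n, (if i = j then (3 : ℝ) else 1) = n * (n + 2) := by
    have (i j : Fin n) : (if i = j then (3 : ℝ) else 1) = 1 + if i = j then 2 else 0 := by
      split_ifs <;> norm_num
    simp [this, Finset.sum_add_distrib]
    ring
  rw [hs] at h
  rw [hp]
  congr 1
  have : (n : ℝ) ≠ 0 := by exact_mod_cast hn0
  push_cast at h
  field_simp at h ⊢
  linear_combination h

lemma integral_unif_isoBall_mul_mul_mul {n : ℕ} (hn : 2 ≤ n) (i j k l : Fin n) :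
    ∫ x, x i * x j * x k * x l ∂(unif (isoBall n)) =
      ((n : ℝ) + 2) / (n + 4) *
        ((if i = j then if k = l then 1 else 0 else 0) +
          (if i = k then if j = l then 1 else 0 else 0) +
          (if i = l then if j = k then 1 else 0 else 0)) := by
  by_cases h : i ≠ j ∧ i ≠ k ∧ i ≠ l
  · simp [integral_unif_isoBall_mul_mul_mul_eq_zero h.1 h.2.1 h.2.2, h]
  have key (a b c : Fin n) : ∫ x, x a * x a * x b * x c ∂(unif (isoBall n)) =
      ((n : ℝ) + 2) / (n + 4) *
        (if b = c then if a = b then 3 else 1 else 0) := by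
    rcases eq_or_ne b c with rfl | hbc
    · rw [if_pos rfl, ← integral_unif_isoBall_sq_mul_sq hn]
      congr with x
      ring
    rw [if_neg hbc, mul_zero]
    rcases eq_or_ne b a with rfl | hba
    · rw [← integral_unif_isoBall_mul_mul_mul_eq_zero hbc.symm hbc.symm hbc.symm]
      congr with x
      ring
    · rw [← integral_unif_isoBall_mul_mul_mul_eq_zero hba hba hbc]
      congr with x
      ring
  obtain rfl | rfl | rfl : i = j ∨ i = k ∨ i = l := by tauto
  · rw [key]
    grind
  · rw [show (∫ x, x i * x j * x i * x l ∂(unif (isoBall n))) =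
      ∫ x, x i * x i * x j * x l ∂(unif (isoBall n)) by congr with x; ring, key]
    grind
  · rw [show (∫ x, x i * x j * x k * x i ∂(unif (isoBall n))) =
      ∫ x, x i * x i * x j * x k ∂(unif (isoBall n)) by congr with x; ring, key]
    grind

lemma integral_unif_isoBall_quadratic {n : ℕ} (hn : n ≠ 0) {A : Fin n → Fin n → ℝ}
    (hA : ∑ i, A i i = 0) :
    ∫ x, (∑ i, ∑ j, A i j * (x i * x j)) ∂(unif (isoBall n)) = 0 := by
  have hI {f : (Fin n → ℝ) → ℝ} (hf : Continuous f) := integrable_unif_isoBall hn hf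
  rw [integral_finsetSum _ fun i _ ↦ hI (by fun_prop)]
  have : NeZero n := ⟨hn⟩
  have h (i : Fin n) : ∫ x, (∑ j, A i j * (x i * x j)) ∂(unif (isoBall n)) =
      A i i * ∫ x, x 0 ^ 2 ∂(unif (isoBall n)) := by
    rw [integral_finsetSum _ fun i _ ↦ hI (by fun_prop), Finset.sum_eq_single i]
    · rw [integral_const_mul, integral_unif_isoBall_sq_eq 0 i]
      simp_rw [sq]
    · intro j _ hj
      rw [integral_const_mul, integral_unif_isoBall_mul_eq_zero hj.symm, mul_zero]
    · simp
  simp_rw [h, ← Finset.sum_mul, hA, zero_mul]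

lemma integral_unif_isoBall_quadratic_sq {n : ℕ} (hn : 2 ≤ n) (A : Fin n → Fin n → ℝ) :
    ∫ x, (∑ i, ∑ j, A i j * (x i * x j)) ^ 2 ∂(unif (isoBall n)) =
      ((n : ℝ) + 2) / (n + 4) *
        ((∑ i, A i i) ^ 2 + ∑ i, ∑ j, A i j ^ 2 + ∑ i, ∑ j, A i j * A j i) := by
  have hn0 : n ≠ 0 := by omega
  have hI {f : (Fin n → ℝ) → ℝ} (hf : Continuous f) := integrable_unif_isoBall hn0 hf
  have hx (x : Fin n → ℝ) : (∑ i, ∑ j, A i j * (x i * x j)) ^ 2 =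
      ∑ i, ∑ j, ∑ k, ∑ l, A i j * A k l * (x i * x j * x k * x l) := by
    simp_rw [sq, Finset.sum_mul, Finset.mul_sum]
    iterate 4 refine Finset.sum_congr rfl fun _ _ ↦ ?_
    ring
  simp_rw [hx]
  rw [integral_finsetSum _ fun i _ ↦ hI (by fun_prop)]
  have h (i j : Fin n) : ∫ x, (∑ k, ∑ l, A i j * A k l * (x i * x j * x k * x l))
      ∂(unif (isoBall n)) = ((n : ℝ) + 2) / (n + 4) *
        ((if i = j then A i j * ∑ k, A k k else 0) + A i j ^ 2 + A i j * A j i) := by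
    rw [integral_finsetSum _ fun i _ ↦ hI (by fun_prop)]
    have h' (k : Fin n) := integral_finsetSum (μ := unif (isoBall n)) Finset.univ fun l _ ↦ hI
      (f := fun x ↦ A i j * A k l * (x i * x j * x k * x l)) (by fun_prop)
    simp_rw [h', integral_const_mul,
      integral_unif_isoBall_mul_mul_mul hn, mul_left_comm _ (((n : ℝ) + 2) / (n + 4)),
      ← Finset.mul_sum]
    congr 1
    simp [mul_add, Finset.sum_add_distrib, Finset.mul_sum, sq]
  have h' (i : Fin n) := integral_finsetSum (μ := unif (isoBall n)) Finset.univ fun j _ ↦ hI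
    (f := fun x ↦ ∑ k, ∑ l, A i j * A k l * (x i * x j * x k * x l)) (by fun_prop)
  simp_rw [h', h, ← Finset.mul_sum, Finset.sum_add_distrib]
  simp [sq, Finset.sum_mul]

lemma sum_support_eq_sum_single_add_single {n : ℕ} {f : MvPolynomial (Fin n) ℝ}
    (hf : f.IsHomogeneous 2) {g : (Fin n →₀ ℕ) → ℝ} (hg : ∀ m, f.coeff m = 0 → g m = 0) :
    ∑ m ∈ f.support, g m =
      ∑ i, ∑ j, if i ≤ j then g (Finsupp.single i 1 + Finsupp.single j 1) else 0 := by
  rw [← Finset.sum_product', ← Finset.sum_filter, Finset.univ_product_univ]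
  have hinj : Set.InjOn (fun p : Fin n × Fin n ↦ Finsupp.single p.1 1 + Finsupp.single p.2 1)
      (Finset.univ.filter fun p : Fin n × Fin n ↦ p.1 ≤ p.2 : Finset _) := by
    rintro ⟨a, b⟩ hab ⟨c, d⟩ hcd h
    simp at hab hcd
    simp [Finsupp.single_add_single_eq_single_add_single] at h
    grind
  rw [← Finset.sum_image (f := g) hinj]
  refine Finset.sum_subset (fun m hm ↦ ?_) fun m _ hm ↦ hg m (by simpa using hm)
  have hdeg := hf (MvPolynomial.mem_support_iff.1 hm)
  have hcard : Multiset.card (Finsupp.toMultiset m) = 2 := by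
    rw [Finsupp.card_toMultiset, ← hdeg]
    simp [Finsupp.weight_apply]
    rfl
  obtain ⟨a, b, hab⟩ := Multiset.card_eq_two.1 hcard
  have hm' : m = Finsupp.single a 1 + Finsupp.single b 1 := by
    rw [← Finsupp.toMultiset_toFinsupp m, hab, Multiset.insert_eq_cons, ← Multiset.singleton_add,
      Multiset.toFinsupp_add, Multiset.toFinsupp_singleton, Multiset.toFinsupp_singleton]
  simp only [Finset.mem_image, Finset.mem_filter, Finset.mem_univ, true_and, Prod.exists]
  rcases le_total a b with h | h
  · exact ⟨a, b, h, hm'.symm⟩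
  · exact ⟨b, a, h, by rw [hm', add_comm]⟩

/-- the pathological spectral gap for `d = 2` on the isotropic Euclidean ball:
the variance of `∑ Xᵢ²` is `4n/(n+4)`, while for degree-2 homogeneous polynomials whose
coefficient vector is orthogonal to that of `∑ xᵢ²` the variance is at least `(5/7)·∑ α_I²`. -/
theorem stmt17 (n : ℕ) (hn : 3 ≤ n) :
    ((∫ x, (∑ i, (x i) ^ 2) ^ 2 ∂(unif (isoBall n))) -
        (∫ x, (∑ i, (x i) ^ 2) ∂(unif (isoBall n))) ^ 2 =
      4 * (n : ℝ) / ((n : ℝ) + 4)) ∧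
    ∀ f : MvPolynomial (Fin n) ℝ, f.IsHomogeneous 2 →
      (∑ i, f.coeff (Finsupp.single i 2)) = 0 →
      (∫ x, (MvPolynomial.eval x f) ^ 2 ∂(unif (isoBall n))) -
          (∫ x, MvPolynomial.eval x f ∂(unif (isoBall n))) ^ 2 ≥
        (5 / 7) * ∑ m ∈ f.support, f.coeff m ^ 2 := by
  have hn0 : n ≠ 0 := by omega
  have hn3 : (3 : ℝ) ≤ n := by exact_mod_cast hn
  constructor
  · have h1 := integral_unif_isoBall_sum_sq_pow hn0 1
    have h2 := integral_unif_isoBall_sum_sq_pow hn0 2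
    simp only [pow_one] at h1
    rw [h1, h2]
    push_cast
    field_simp
    ring
  intro f hf htr
  let A (i j : Fin n) : ℝ :=
    if i ≤ j then f.coeff (Finsupp.single i 1 + Finsupp.single j 1) else 0
  have hA : ∑ i, A i i = 0 := by
    simpa [A, ← Finsupp.single_add] using htr
  have heval (x : Fin n → ℝ) : MvPolynomial.eval x f = ∑ i, ∑ j, A i j * (x i * x j) := by
    rw [MvPolynomial.eval_eq', sum_support_eq_sum_single_add_single hf (fun m hm ↦ by simp [hm])]
    refine Finset.sum_congr rfl fun i _ ↦ Finset.sum_congr rfl fun j _ ↦ ?_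
    simp only [A, ite_mul, zero_mul]
    congr 2
    simp_rw [Finsupp.add_apply, pow_add, Finset.prod_mul_distrib]
    simp [Finsupp.single_apply, pow_ite]
  have hcoeff : ∑ m ∈ f.support, f.coeff m ^ 2 = ∑ i, ∑ j, A i j ^ 2 := by
    rw [sum_support_eq_sum_single_add_single hf (fun m hm ↦ by simp [hm])]
    simp [A, ite_pow]
  simp_rw [heval]
  rw [hcoeff, integral_unif_isoBall_quadratic hn0 hA,
    integral_unif_isoBall_quadratic_sq (by omega), hA]
  have h1 : 0 ≤ ∑ i, ∑ j, A i j ^ 2 :=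
    Finset.sum_nonneg fun i _ ↦ Finset.sum_nonneg fun j _ ↦ sq_nonneg _
  have h2 : 0 ≤ ∑ i, ∑ j, A i j * A j i := by
    refine Finset.sum_nonneg fun i _ ↦ Finset.sum_nonneg fun j _ ↦ ?_
    by_cases hij : i = j
    · subst hij
      exact mul_self_nonneg _
    · refine le_of_eq ?_
      rcases lt_or_gt_of_ne hij with h | h <;> simp [A, h.not_ge]
  have h3 : (5 : ℝ) / 7 ≤ ((n : ℝ) + 2) / (n + 4) := by
    rw [div_le_div_iff₀ (by norm_num) (by positivity)]
    linarith
  nlinarith [mul_le_mul_of_nonneg_right h3 h1,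
    mul_nonneg ((by norm_num : (0 : ℝ) ≤ 5 / 7).trans h3) h2]
end
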